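/- arXiv:1208.3801 — 2 statements merged into one kernel-verified Lean document; each statement's English description precedes it below -/
import Mathlib

section
/- Suppose p = o(1) and d = p(n−1) ≫ log³ n. Let i ≥ 1 be the largest integer such that d^i = o(n) and let c = d^{i+1}/n. Then for G ∈ G(n,p), asymptotically almost surely, for every pair of distinct vertices x, y, the number of vertices z with d_G(z,x) ≠ d_G(z,y) is at least (2 + o(1)) · (d^i + e^{−c}(1 − e^{−c}) n). -/
open Filter Real Asymptotics
open scoped Topology

/-- `R` is a resolving set of the graph `G`: every pair of distinct vertices is
distinguished by its distances to some vertex of `R`. -/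
def Resolves {V : Type*} (G : SimpleGraph V) (R : Set V) : Prop :=
  ∀ ⦃v w : V⦄, v ≠ w → ∃ u ∈ R, G.dist u v ≠ G.dist u w

/-- The metric dimension of a graph `G`: the smallest cardinality of a resolving set. -/
noncomputable def metricDim {V : Type*} (G : SimpleGraph V) : ℕ :=
  sInf {k : ℕ | ∃ R : Set V, R.Finite ∧ R.ncard = k ∧ Resolves G R}

/-- The `G(n,p)` probability weight of a single graph on `Fin n`. -/
noncomputable def gnpWeight (n : ℕ) (p : ℝ) (G : SimpleGraph (Fin n)) : ℝ :=
  p ^ Nat.card G.edgeSet * (1 - p) ^ (n.choose 2 - Nat.card G.edgeSet)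

/-- The probability of an event `A` under the binomial random graph `G(n,p)`. -/
noncomputable def gnpProb (n : ℕ) (p : ℝ) (A : Set (SimpleGraph (Fin n))) : ℝ :=
  ∑' G : SimpleGraph (Fin n), A.indicator (gnpWeight n p) G

/-- `S(v,i)`: the set of vertices at graph distance exactly `i` from `v`. -/
def gSphere {V : Type*} (G : SimpleGraph V) (v : V) (i : ℕ) : Set V :=
  {u | G.Reachable v u ∧ G.dist v u = i}

/-- `N(v,i)`: the set of vertices at graph distance at most `i` from `v`. -/
def gBall {V : Type*} (G : SimpleGraph V) (v : V) (i : ℕ) : Set V :=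
  {u | G.Reachable v u ∧ G.dist v u ≤ i}

/-- `S(V',i)`: union of the spheres around the vertices of `V'`. -/
def gSphereSet {V : Type*} (G : SimpleGraph V) (W : Set V) (i : ℕ) : Set V :=
  ⋃ v ∈ W, gSphere G v i

/-- `N(V',i)`: union of the balls around the vertices of `V'`. -/
def gBallSet {V : Type*} (G : SimpleGraph V) (W : Set V) (i : ℕ) : Set V :=
  ⋃ v ∈ W, gBall G v i

/-- The weight of a configuration of independent coins with success probability `p`. -/
noncomputable def coinWeight {ι : Type*} [Fintype ι] (p : ℝ) (ω : ι → Bool) : ℝ :=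
  ∏ e, if ω e then p else 1 - p

/-- Expectation with respect to independent coins with success probability `p`. -/
noncomputable def coinExp {ι : Type*} [Fintype ι] [DecidableEq ι] (p : ℝ)
    (f : (ι → Bool) → ℝ) : ℝ :=
  ∑ ω, coinWeight p ω * f ω

/-- Probability with respect to independent coins with success probability `p`. -/
noncomputable def coinProb {ι : Type*} [Fintype ι] [DecidableEq ι] (p : ℝ)
    (S : Set (ι → Bool)) : ℝ :=
  coinExp p (S.indicator 1)

section Coins

lemma DependsOn.finset_prod {ι κ : Type*} {f : κ → (ι → Bool) → ℝ} {T : κ → Set ι} (Z : Finset κ)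
    (h : ∀ z ∈ Z, DependsOn (f z) (T z)) :
    DependsOn (fun ω => ∏ z ∈ Z, f z ω) (⋃ z ∈ Z, T z) := by
  intro ω ω' hω
  refine Finset.prod_congr rfl fun z hz => h z hz fun i hi => hω i ?_
  simp only [Set.mem_iUnion]
  exact ⟨z, hz, hi⟩

variable {ι κ : Type*} [Fintype ι] {p : ℝ}

lemma coinWeight_nonneg (hp : 0 ≤ p) (hp1 : p ≤ 1) (ω : ι → Bool) : 0 ≤ coinWeight p ω :=
  Finset.prod_nonneg fun e _ => by split_ifs <;> linarith

variable [DecidableEq ι]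

lemma coinExp_prod (φ : ι → Bool → ℝ) :
    coinExp p (fun ω => ∏ e, φ e (ω e)) = ∏ e, (p * φ e true + (1 - p) * φ e false) := by
  have h := Finset.prod_univ_sum (fun _ : ι => (Finset.univ : Finset Bool))
    (fun e b => (if b then p else 1 - p) * φ e b)
  simp only [Fintype.piFinset_univ, Fintype.sum_bool, if_true, Bool.false_eq_true, if_false] at h
  rw [h, coinExp]
  refine Finset.sum_congr rfl fun ω _ => ?_
  rw [coinWeight, ← Finset.prod_mul_distrib]

lemma coinExp_one : coinExp p (fun _ : ι → Bool => 1) = 1 := by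
  have h := coinExp_prod (ι := ι) (p := p) (fun _ _ => 1)
  simpa using h

lemma coinExp_mono (hp : 0 ≤ p) (hp1 : p ≤ 1) {f g : (ι → Bool) → ℝ} (h : ∀ ω, f ω ≤ g ω) :
    coinExp p f ≤ coinExp p g :=
  Finset.sum_le_sum fun ω _ => mul_le_mul_of_nonneg_left (h ω) (coinWeight_nonneg hp hp1 ω)

lemma coinExp_sub (f g : (ι → Bool) → ℝ) :
    coinExp p (fun ω => f ω - g ω) = coinExp p f - coinExp p g := by
  simp [coinExp, mul_sub]

lemma coinExp_add (f g : (ι → Bool) → ℝ) :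
    coinExp p (fun ω => f ω + g ω) = coinExp p f + coinExp p g := by
  simp [coinExp, mul_add, Finset.sum_add_distrib]

lemma coinExp_const_mul (a : ℝ) (f : (ι → Bool) → ℝ) :
    coinExp p (fun ω => a * f ω) = a * coinExp p f := by
  simp only [coinExp, Finset.mul_sum]
  exact Finset.sum_congr rfl fun ω _ => by ring

lemma coinExp_sum (s : Finset κ) (f : κ → (ι → Bool) → ℝ) :
    coinExp p (fun ω => ∑ k ∈ s, f k ω) = ∑ k ∈ s, coinExp p (f k) := by
  simp only [coinExp, Finset.mul_sum]
  exact Finset.sum_comm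

lemma coinProb_le_coinExp (hp : 0 ≤ p) (hp1 : p ≤ 1) {S : Set (ι → Bool)}
    {f : (ι → Bool) → ℝ} (hf : ∀ ω, 0 ≤ f ω) (h : ∀ ω ∈ S, 1 ≤ f ω) :
    coinProb p S ≤ coinExp p f := by
  refine coinExp_mono hp hp1 fun ω => ?_
  by_cases hω : ω ∈ S
  · simpa [hω] using h ω hω
  · simpa [hω] using hf ω

lemma coinProb_nonneg (hp : 0 ≤ p) (hp1 : p ≤ 1) (S : Set (ι → Bool)) : 0 ≤ coinProb p S :=
  Finset.sum_nonneg fun ω _ => mul_nonneg (coinWeight_nonneg hp hp1 ω)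
    (Set.indicator_nonneg (fun _ _ => zero_le_one) ω)

lemma coinProb_mono (hp : 0 ≤ p) (hp1 : p ≤ 1) {S T : Set (ι → Bool)} (h : S ⊆ T) :
    coinProb p S ≤ coinProb p T :=
  coinExp_mono hp hp1 fun ω => Set.indicator_le_indicator_of_subset h (fun _ => zero_le_one) ω

lemma coinProb_compl (S : Set (ι → Bool)) : coinProb p Sᶜ = 1 - coinProb p S := by
  rw [coinProb, coinProb, ← coinExp_one (ι := ι) (p := p), ← coinExp_sub]
  congr 1
  ext ω
  by_cases h : ω ∈ S <;> simp [h]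

lemma coinProb_le_one (hp : 0 ≤ p) (hp1 : p ≤ 1) (S : Set (ι → Bool)) : coinProb p S ≤ 1 := by
  have h := coinProb_nonneg hp hp1 Sᶜ
  rw [coinProb_compl] at h
  linarith

/-- The union bound. -/
lemma coinProb_exists_le (hp : 0 ≤ p) (hp1 : p ≤ 1) (s : Finset κ) (S : κ → Set (ι → Bool)) :
    coinProb p {ω | ∃ k ∈ s, ω ∈ S k} ≤ ∑ k ∈ s, coinProb p (S k) := by
  simp only [coinProb]
  rw [← coinExp_sum]
  refine coinProb_le_coinExp hp hp1 (fun ω => Finset.sum_nonneg fun k _ =>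
    Set.indicator_nonneg (fun _ _ => zero_le_one) ω) ?_
  rintro ω ⟨k, hk, hω⟩
  have h := Finset.single_le_sum (f := fun k => (S k).indicator (1 : (ι → Bool) → ℝ) ω)
    (fun k _ => Set.indicator_nonneg (fun _ _ => zero_le_one) ω) hk
  simpa [hω] using h

lemma coinProb_union_le (hp : 0 ≤ p) (hp1 : p ≤ 1) (S T : Set (ι → Bool)) :
    coinProb p (S ∪ T) ≤ coinProb p S + coinProb p T := by
  rw [coinProb, coinProb, coinProb, ← coinExp_add]
  refine coinExp_mono hp hp1 fun ω => ?_
  by_cases h1 : ω ∈ S <;> by_cases h2 : ω ∈ T <;> simp [h1, h2]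

lemma coinExp_mul_of_dependsOn {f g : (ι → Bool) → ℝ} {s t : Set ι} (hf : DependsOn f s)
    (hg : DependsOn g t) (hst : Disjoint s t) :
    coinExp p (fun ω => f ω * g ω) = coinExp p f * coinExp p g := by
  classical
  let w₁ : ({i // i ∈ s} → Bool) → ℝ := fun a => ∏ e, if a e then p else 1 - p
  let w₂ : ({i // i ∉ s} → Bool) → ℝ := fun b => ∏ e, if b e then p else 1 - p
  let E := Equiv.piEquivPiSubtypeProd (· ∈ s) (fun _ : ι => Bool)
  let F : ((ι → Bool) → ℝ) → ({i // i ∈ s} → Bool) → ℝ :=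
    fun f a => f (E.symm (a, fun _ => false))
  let G : ((ι → Bool) → ℝ) → ({i // i ∉ s} → Bool) → ℝ :=
    fun g b => g (E.symm (fun _ => false, b))
  have key : ∀ f g : (ι → Bool) → ℝ, DependsOn f s → DependsOn g t →
      coinExp p (fun ω => f ω * g ω) = (∑ a, w₁ a * F f a) * ∑ b, w₂ b * G g b := by
    intro f g hf hg
    rw [coinExp, ← E.symm.sum_comp, Fintype.sum_prod_type, Finset.sum_mul_sum]
    refine Finset.sum_congr rfl fun a _ => Finset.sum_congr rfl fun b _ => ?_
    have h₁ : f (E.symm (a, b)) = F f a := hf fun i hi => by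
      simp [E, Equiv.piEquivPiSubtypeProd, hi]
    have h₂ : g (E.symm (a, b)) = G g b := hg fun i hi => by
      have : i ∉ s := fun h => hst.ne_of_mem h hi rfl
      simp [E, Equiv.piEquivPiSubtypeProd, this]
    have h₃ : coinWeight p (E.symm (a, b)) = w₁ a * w₂ b := by
      rw [coinWeight, ← Fintype.prod_subtype_mul_prod_subtype (· ∈ s)]
      congr 1 <;> refine Finset.prod_congr rfl fun i _ => ?_
      · simp [E, Equiv.piEquivPiSubtypeProd]
      · simp [E, Equiv.piEquivPiSubtypeProd, i.2]
    rw [h₁, h₂, h₃]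
    ring
  have c₁ : ∀ u : Set ι, DependsOn (fun _ : ι → Bool => (1 : ℝ)) u := fun u _ _ _ => rfl
  have k₁ := key f _ hf (c₁ t)
  have k₂ := key _ g (c₁ s) hg
  have k₃ := key _ _ (c₁ s) (c₁ t)
  simp only [mul_one, one_mul] at k₁ k₂ k₃
  rw [coinExp_one] at k₃
  rw [key f g hf hg, k₁, k₂]
  linear_combination (∑ a, w₁ a * F f a) * (∑ b, w₂ b * G g b) * k₃

lemma coinExp_prod_blocks [DecidableEq κ] (Z : Finset κ) (T : κ → Set ι)
    (f : κ → (ι → Bool) → ℝ) (hf : ∀ z ∈ Z, DependsOn (f z) (T z))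
    (hT : (Z : Set κ).PairwiseDisjoint T) :
    coinExp p (fun ω => ∏ z ∈ Z, f z ω) = ∏ z ∈ Z, coinExp p (f z) := by
  induction Z using Finset.induction_on with
  | empty => simpa using coinExp_one
  | insert a Z ha ih =>
    simp only [Finset.prod_insert ha]
    rw [coinExp_mul_of_dependsOn (hf a (Finset.mem_insert_self _ _))
      (DependsOn.finset_prod Z fun z hz => hf z (Finset.mem_insert_of_mem hz)),
      ih (fun z hz => hf z (Finset.mem_insert_of_mem hz))
        (hT.subset (by simp))]
    simp only [Set.disjoint_iUnion_right]
    intro z hz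
    exact hT (by simp) (by simp [hz]) (by rintro rfl; exact ha hz)

open Classical in
/-- The moment generating function of the number of occurrences of independent events. -/
lemma coinExp_exp_card_le (hp : 0 ≤ p) (hp1 : p ≤ 1) (Z : Finset κ) (T : κ → Set ι)
    (X : κ → Set (ι → Bool)) (hX : ∀ z ∈ Z, DependsOn (fun ω => ω ∈ X z) (T z))
    (hT : (Z : Set κ).PairwiseDisjoint T) {r : ℝ} (hr : ∀ z ∈ Z, coinProb p (X z) = r) (t : ℝ) :
    coinExp p (fun ω => Real.exp (t * (Z.filter (fun z => ω ∈ X z)).card)) ≤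
      Real.exp (Z.card * r * (Real.exp t - 1)) := by
  have h₁ : ∀ ω : ι → Bool, Real.exp (t * (Z.filter (fun z => ω ∈ X z)).card) =
      ∏ z ∈ Z, (1 + (Real.exp t - 1) * (X z).indicator 1 ω) := by
    intro ω
    rw [mul_comm, Real.exp_nat_mul, ← Finset.prod_const, Finset.prod_filter]
    refine Finset.prod_congr rfl fun z _ => ?_
    by_cases h : ω ∈ X z <;> simp [h]
  simp only [h₁]
  rw [coinExp_prod_blocks Z T _ _ hT]
  · have h₂ : ∀ z ∈ Z, coinExp p (fun ω => 1 + (Real.exp t - 1) * (X z).indicator 1 ω) =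
        1 + r * (Real.exp t - 1) := by
      intro z hz
      rw [coinExp_add, coinExp_one, coinExp_const_mul, ← coinProb, hr z hz, mul_comm]
    rw [Finset.prod_congr rfl h₂, Finset.prod_const, mul_assoc, Real.exp_nat_mul]
    rcases Z.eq_empty_or_nonempty with rfl | ⟨z, hz⟩
    · simp
    refine pow_le_pow_left₀ ?_ (by linarith [Real.add_one_le_exp (r * (Real.exp t - 1))]) _
    have h₀ := coinProb_nonneg hp hp1 (X z)
    have h₁ := coinProb_le_one hp hp1 (X z)
    rw [hr z hz] at h₀ h₁
    nlinarith [Real.exp_pos t]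
  · intro z hz ω ω' hω
    have := hX z hz hω
    simp only [eq_iff_iff] at this
    by_cases h : ω ∈ X z
    · simp [h, this.1 h]
    · simp [h, mt this.2 h]

open Classical in
private lemma coinProb_tail (hp : 0 ≤ p) (hp1 : p ≤ 1) (Z : Finset κ) (T : κ → Set ι)
    (X : κ → Set (ι → Bool)) (hX : ∀ z ∈ Z, DependsOn (fun ω => ω ∈ X z) (T z))
    (hT : (Z : Set κ).PairwiseDisjoint T) {r : ℝ} (hr : ∀ z ∈ Z, coinProb p (X z) = r)
    {M t : ℝ} (hM0 : 0 ≤ M) (ht : |t| ≤ 1) (hM : Z.card * r * (Real.exp t - 1) ≤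
      M * (Real.exp t - 1)) :
    coinProb p {ω | t * ((1 + 2 * t) * M) ≤ t * (Z.filter (fun z => ω ∈ X z)).card} ≤
      Real.exp (-(t ^ 2 * M)) := by
  have h := coinExp_exp_card_le hp hp1 Z T X hX hT hr t
  have h₁ : coinProb p {ω | t * ((1 + 2 * t) * M) ≤ t * (Z.filter (fun z => ω ∈ X z)).card} ≤
      coinExp p (fun ω => Real.exp (-(t * ((1 + 2 * t) * M))) *
        Real.exp (t * (Z.filter (fun z => ω ∈ X z)).card)) := by
    refine coinProb_le_coinExp hp hp1 (fun ω => by positivity) fun ω hω => ?_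
    rw [← Real.exp_add]
    refine Real.one_le_exp ?_
    rw [Set.mem_ofPred_eq] at hω
    linarith
  rw [coinExp_const_mul] at h₁
  refine h₁.trans ((mul_le_mul_of_nonneg_left h (Real.exp_pos _).le).trans ?_)
  rw [← Real.exp_add, Real.exp_le_exp]
  have h₂ := (abs_le.1 (Real.abs_exp_sub_one_sub_id_le ht)).2
  nlinarith [mul_le_mul_of_nonneg_left h₂ hM0]

open Classical in
/-- Chernoff's bound for the upper tail. -/
lemma coinProb_upper_tail (hp : 0 ≤ p) (hp1 : p ≤ 1) (Z : Finset κ) (T : κ → Set ι)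
    (X : κ → Set (ι → Bool)) (hX : ∀ z ∈ Z, DependsOn (fun ω => ω ∈ X z) (T z))
    (hT : (Z : Set κ).PairwiseDisjoint T) {r : ℝ} (hr : ∀ z ∈ Z, coinProb p (X z) = r)
    {M ε : ℝ} (hM0 : 0 ≤ M) (hM : Z.card * r ≤ M) (hε : 0 ≤ ε) (hε1 : ε ≤ 1) :
    coinProb p {ω | (1 + ε) * M ≤ (Z.filter (fun z => ω ∈ X z)).card} ≤
      Real.exp (-(ε ^ 2 * M / 4)) := by
  have h := coinProb_tail hp hp1 Z T X hX hT hr (t := ε / 2) hM0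
    (abs_le.2 ⟨by linarith, by linarith⟩)
    (mul_le_mul_of_nonneg_right hM (by linarith [Real.add_one_le_exp (ε / 2)]))
  refine (coinProb_mono hp hp1 fun ω hω => ?_).trans (h.trans_eq (by ring_nf))
  rw [Set.mem_ofPred_eq] at hω ⊢
  rw [show 1 + 2 * (ε / 2) = 1 + ε by ring]
  exact mul_le_mul_of_nonneg_left hω (by linarith)

open Classical in
/-- Chernoff's bound for the lower tail. -/
lemma coinProb_lower_tail (hp : 0 ≤ p) (hp1 : p ≤ 1) (Z : Finset κ) (T : κ → Set ι)
    (X : κ → Set (ι → Bool)) (hX : ∀ z ∈ Z, DependsOn (fun ω => ω ∈ X z) (T z))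
    (hT : (Z : Set κ).PairwiseDisjoint T) {r : ℝ} (hr : ∀ z ∈ Z, coinProb p (X z) = r)
    {M ε : ℝ} (hM0 : 0 ≤ M) (hM : M ≤ Z.card * r) (hε : 0 ≤ ε) (hε1 : ε ≤ 1) :
    coinProb p {ω | ((Z.filter (fun z => ω ∈ X z)).card : ℝ) ≤ (1 - ε) * M} ≤
      Real.exp (-(ε ^ 2 * M / 4)) := by
  have h := coinProb_tail hp hp1 Z T X hX hT hr (t := -(ε / 2)) hM0
    (abs_le.2 ⟨by linarith, by linarith⟩)
    (mul_le_mul_of_nonpos_right hM (by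
      linarith [Real.exp_le_one_iff.2 (show -(ε / 2) ≤ 0 by linarith)]))
  refine (coinProb_mono hp hp1 fun ω hω => ?_).trans (h.trans_eq (by ring_nf))
  rw [Set.mem_ofPred_eq] at hω ⊢
  rw [show 1 + 2 * -(ε / 2) = 1 - ε by ring]
  exact mul_le_mul_of_nonpos_left hω (by linarith)

/-- If, for each value `s` of `σ`, the event `X s` is determined by coins disjoint from those
determining whether `σ = s`, then a uniform bound on the probabilities of the `X s` carries over
to the event `X (σ ω)`. -/
lemma coinProb_decouple [Fintype κ] (hp : 0 ≤ p) (hp1 : p ≤ 1)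
    (σ : (ι → Bool) → κ) (X : κ → Set (ι → Bool)) (R T : κ → Set ι)
    (hσ : ∀ s, DependsOn (fun ω => σ ω = s) (R s)) (hX : ∀ s, DependsOn (fun ω => ω ∈ X s) (T s))
    (hRT : ∀ s, (X s).Nonempty → Disjoint (R s) (T s)) {β : ℝ} (hβ : ∀ s, coinProb p (X s) ≤ β) :
    coinProb p {ω | ω ∈ X (σ ω)} ≤ β := by
  classical
  have hsplit : coinProb p {ω | ω ∈ X (σ ω)} =
      ∑ s, coinExp p (fun ω => {ω | σ ω = s}.indicator 1 ω * (X s).indicator 1 ω) := by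
    rw [← coinExp_sum, coinProb]
    congr 1
    ext ω
    rw [Finset.sum_eq_single (σ ω)]
    · by_cases h : ω ∈ X (σ ω) <;> simp [h]
    · intro s _ hs
      simp [hs.symm]
    · simp
  have hdep : ∀ (S : Set (ι → Bool)) (u : Set ι), DependsOn (fun ω => ω ∈ S) u →
      DependsOn (S.indicator (1 : (ι → Bool) → ℝ)) u := by
    intro S u h ω ω' hω
    have := h hω
    simp only [eq_iff_iff] at this
    by_cases h' : ω ∈ S
    · simp [h', this.1 h']
    · simp [h', mt this.2 h']
  have hone : ∑ s, coinProb p {ω | σ ω = s} = 1 := by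
    simp only [coinProb]
    rw [← coinExp_sum, ← coinExp_one (ι := ι) (p := p)]
    congr 1
    ext ω
    rw [Finset.sum_eq_single (σ ω)] <;> simp +contextual [eq_comm]
  rw [hsplit, ← one_mul β, ← hone, Finset.sum_mul]
  refine Finset.sum_le_sum fun s _ => ?_
  rcases (X s).eq_empty_or_nonempty with h | h
  · have h0 : (0 : ℝ) ≤ β := (coinProb_nonneg hp hp1 (X s)).trans (hβ s)
    simp only [h, Set.indicator_empty, mul_zero]
    exact (by simp [coinExp] : _ = (0 : ℝ)).trans_le (mul_nonneg (coinProb_nonneg hp hp1 _) h0)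
  · rw [coinExp_mul_of_dependsOn (hdep {ω | σ ω = s} _ (hσ s)) (hdep _ _ (hX s)) (hRT s h)]
    exact mul_le_mul_of_nonneg_left (hβ s) (coinProb_nonneg hp hp1 _)

/-- The probability that all the coins in a given set show tails. -/
lemma coinProb_all_false (A : Finset ι) :
    coinProb p {ω | ∀ e ∈ A, ω e = false} = (1 - p) ^ A.card := by
  have h := coinExp_prod (p := p) (fun (e : ι) b => if e ∈ A then (if b then 0 else 1) else (1 : ℝ))
  have h₁ : ∏ e, (p * (if e ∈ A then (if true then 0 else 1) else (1 : ℝ)) +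
      (1 - p) * (if e ∈ A then (if false then 0 else 1) else (1 : ℝ))) = (1 - p) ^ A.card := by
    rw [← Finset.prod_const, ← Finset.prod_subset (Finset.subset_univ A)]
    · exact Finset.prod_congr rfl fun e he => by simp [he]
    · intro e _ he
      simp [he]
  rw [← h₁, ← h, coinProb]
  congr 1
  ext ω
  by_cases hω : ∀ e ∈ A, ω e = false
  · rw [Set.indicator_of_mem (by exact hω)]
    refine (Finset.prod_eq_one fun e _ => ?_).symm
    by_cases he : e ∈ A <;> simp [he, hω]
  · rw [Set.indicator_of_notMem (by exact hω)]
    push Not at hω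
    obtain ⟨e, he, hω⟩ := hω
    refine (Finset.prod_eq_zero (Finset.mem_univ e) ?_).symm
    simpa [he] using hω

/-- The probability that all the coins in `B`, but not all those in `A`, show tails. -/
lemma coinProb_all_false_not {A B : Finset ι} (hAB : Disjoint A B) :
    coinProb p {ω | (∃ e ∈ A, ω e = true) ∧ ∀ e ∈ B, ω e = false} =
      (1 - p) ^ B.card * (1 - (1 - p) ^ A.card) := by
  have h : coinProb p {ω | (∃ e ∈ A, ω e = true) ∧ ∀ e ∈ B, ω e = false} =
      coinProb p {ω : ι → Bool | ∀ e ∈ B, ω e = false} -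
        coinProb p {ω : ι → Bool | ∀ e ∈ A ∪ B, ω e = false} := by
    rw [coinProb, coinProb, coinProb, ← coinExp_sub]
    congr 1
    ext ω
    by_cases hB : ∀ e ∈ B, ω e = false
    · by_cases hA : ∃ e ∈ A, ω e = true
      · rw [Set.indicator_of_mem (by exact ⟨hA, hB⟩), Set.indicator_of_mem (by exact hB),
          Set.indicator_of_notMem]
        · simp
        · obtain ⟨e, he, hA⟩ := hA
          intro h
          have := h e (Finset.mem_union_left _ he)
          simp [hA] at this
      · rw [Set.indicator_of_notMem (fun h => hA h.1), Set.indicator_of_mem (by exact hB),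
          Set.indicator_of_mem]
        · simp
        · intro e he
          rcases Finset.mem_union.1 he with he | he
          · by_contra hne
            exact hA ⟨e, he, by simpa using hne⟩
          · exact hB e he
    · rw [Set.indicator_of_notMem (fun h => hB h.2), Set.indicator_of_notMem (by exact hB),
        Set.indicator_of_notMem]
      swap
      · intro h
        exact hB fun e he => (show ∀ e ∈ A ∪ B, ω e = false from h) e (Finset.mem_union_right _ he)
      simp
  rw [h, coinProb_all_false, coinProb_all_false, Finset.card_union_of_disjoint hAB]
  ring

end Coins

section Graph

variable {V : Type*} [Fintype V]

/-- The vertices lying in `A` or adjacent to a vertex of `A`. -/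
noncomputable def closedNbhd (G : SimpleGraph V) (A : Finset V) : Finset V := by
  classical exact Finset.univ.filter fun z => z ∈ A ∨ ∃ a ∈ A, G.Adj a z

/-- The vertices at distance at most `j` from some vertex of `A`. -/
noncomputable def finBall (G : SimpleGraph V) (A : Finset V) (j : ℕ) : Finset V :=
  (closedNbhd G)^[j] A

variable {G : SimpleGraph V} {A B : Finset V} {x y z : V} {j k : ℕ}

lemma mem_closedNbhd : z ∈ closedNbhd G A ↔ z ∈ A ∨ ∃ a ∈ A, G.Adj a z := by
  simp [closedNbhd]

lemma subset_closedNbhd : A ⊆ closedNbhd G A := fun _ h => mem_closedNbhd.2 (Or.inl h)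

lemma closedNbhd_mono (h : A ⊆ B) : closedNbhd G A ⊆ closedNbhd G B := fun z hz => by
  rw [mem_closedNbhd] at hz ⊢
  exact hz.imp (fun h' => h h') fun ⟨a, ha, h'⟩ => ⟨a, h ha, h'⟩

lemma closedNbhd_union [DecidableEq V] :
    closedNbhd G (A ∪ B) = closedNbhd G A ∪ closedNbhd G B := by
  ext z
  simp only [mem_closedNbhd, Finset.mem_union]
  grind

@[simp] lemma finBall_zero : finBall G A 0 = A := rfl

lemma finBall_succ : finBall G A (j + 1) = closedNbhd G (finBall G A j) :=
  Function.iterate_succ_apply' _ _ _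

lemma finBall_mono_right (h : j ≤ k) : finBall G A j ⊆ finBall G A k := by
  induction k, h using Nat.le_induction with
  | base => rfl
  | succ k _ ih => exact ih.trans (finBall_succ (G := G) ▸ subset_closedNbhd)

lemma finBall_mono_left (h : A ⊆ B) : finBall G A j ⊆ finBall G B j := by
  induction j with
  | zero => exact h
  | succ j ih => rw [finBall_succ, finBall_succ]; exact closedNbhd_mono ih

lemma finBall_union [DecidableEq V] :
    finBall G (A ∪ B) j = finBall G A j ∪ finBall G B j := by
  induction j with
  | zero => rfl
  | succ j ih => rw [finBall_succ, finBall_succ, finBall_succ, ih, closedNbhd_union]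

lemma mem_finBall_iff : z ∈ finBall G A j ↔ ∃ x ∈ A, ∃ w : G.Walk x z, w.length ≤ j := by
  induction j generalizing A with
  | zero =>
    constructor
    · exact fun h => ⟨z, h, SimpleGraph.Walk.nil, le_rfl⟩
    · rintro ⟨x, hx, w, hw⟩
      exact SimpleGraph.Walk.eq_of_length_eq_zero (Nat.le_zero.1 hw) ▸ hx
  | succ j ih =>
    rw [finBall, Function.iterate_succ_apply, ← finBall, ih]
    constructor
    · rintro ⟨x, hx, w, hw⟩
      rcases mem_closedNbhd.1 hx with hx | ⟨a, ha, hax⟩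
      · exact ⟨x, hx, w, hw.trans (Nat.le_succ _)⟩
      · exact ⟨a, ha, SimpleGraph.Walk.cons hax w, by simpa using hw⟩
    · rintro ⟨x, hx, w, hw⟩
      cases w with
      | nil => exact ⟨z, subset_closedNbhd hx, SimpleGraph.Walk.nil, Nat.zero_le _⟩
      | cons h w =>
        exact ⟨_, mem_closedNbhd.2 (Or.inr ⟨x, hx, h⟩), w, by simpa using hw⟩

lemma dist_ne_of_mem_finBall (hx : z ∈ finBall G {x} j) (hy : z ∉ finBall G {y} j) (hne : z ≠ x) :
    G.dist z x ≠ G.dist z y := by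
  obtain ⟨x', hx', w, hw⟩ := mem_finBall_iff.1 hx
  obtain rfl := Finset.mem_singleton.1 hx'
  rw [G.dist_comm, G.dist_comm (u := z)]
  have h₁ : G.dist x' z ≤ j := (SimpleGraph.dist_le w).trans hw
  have h₂ : G.dist x' z ≠ 0 := (w.reachable.pos_dist_of_ne hne.symm).ne'
  intro h
  rw [h] at h₁ h₂
  obtain ⟨w', hw'⟩ := SimpleGraph.exists_walk_of_dist_ne_zero h₂
  exact hy (mem_finBall_iff.2 ⟨y, Finset.mem_singleton_self _, w', hw'.trans_le h₁⟩)

open Classical in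
/-- Vertices outside `P ∪ Q` with a neighbour in `P \ (Q ∪ U)` and none in `Q \ U`. -/
noncomputable def oneSided (G : SimpleGraph V) (U P Q : Finset V) : Finset V :=
  (P ∪ Q)ᶜ.filter fun z => (∃ a ∈ P \ (Q ∪ U), G.Adj a z) ∧ ∀ b ∈ Q \ U, ¬ G.Adj b z

lemma mem_oneSided {U P Q : Finset V} : z ∈ oneSided G U P Q ↔ z ∉ P ∧ z ∉ Q ∧
    (∃ a ∈ P, a ∉ Q ∧ a ∉ U ∧ G.Adj a z) ∧ ∀ b ∈ Q, b ∉ U → ¬ G.Adj b z := by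
  simp only [oneSided, Finset.mem_filter, Finset.mem_compl, Finset.mem_union, Finset.mem_sdiff,
    not_or, and_imp, and_assoc]

lemma card_distinguishing_ge [DecidableEq V] (G : SimpleGraph V) (x y : V) (m : ℕ) :
    (finBall G {x} (m + 1) \ finBall G {y} (m + 1)).card +
      (finBall G {y} (m + 1) \ finBall G {x} (m + 1)).card +
      (oneSided G (finBall G {x, y} m) (finBall G {x} (m + 1)) (finBall G {y} (m + 1))).card +
      (oneSided G (finBall G {x, y} m) (finBall G {y} (m + 1)) (finBall G {x} (m + 1))).card ≤
    {z : V | G.dist z x ≠ G.dist z y}.ncard + 2 := by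
  classical
  obtain rfl := Subsingleton.elim ‹DecidableEq V› fun a b => Classical.propDecidable (a = b)
  set U := finBall G {x, y} m with hU
  set P := finBall G {x} (m + 1) with hP
  set Q := finBall G {y} (m + 1) with hQ
  have hUP : closedNbhd G U = P ∪ Q := by
    rw [hU, hP, hQ, ← finBall_succ, ← finBall_union]; rfl
  have key : ∀ a b : V, U = finBall G {a, b} m →
      ∀ z ∈ oneSided G U (finBall G {a} (m + 1)) (finBall G {b} (m + 1)),
      z ∉ P ∪ Q ∧ G.dist z a ≠ G.dist z b := by
    intro a b hab z hz
    have hPQ : finBall G {a} (m + 1) ∪ finBall G {b} (m + 1) = P ∪ Q := by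
      rw [← hUP, hab, ← finBall_succ, ← finBall_union]; rfl
    simp only [oneSided, Finset.mem_filter, Finset.mem_compl, hPQ] at hz
    obtain ⟨hz, ⟨u, hu, huz⟩, hb⟩ := hz
    refine ⟨hz, dist_ne_of_mem_finBall (j := m + 1 + 1) ?_ ?_ ?_⟩
    · rw [finBall_succ, mem_closedNbhd]
      exact Or.inr ⟨u, (Finset.mem_sdiff.1 hu).1, huz⟩
    · rw [finBall_succ, mem_closedNbhd]
      rintro (h | ⟨v, hv, hvz⟩)
      · exact hz (hPQ ▸ Finset.mem_union_right _ h)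
      · by_cases hvU : v ∈ U
        · exact hz (hUP ▸ mem_closedNbhd.2 (Or.inr ⟨v, hvU, hvz⟩))
        · exact hb v (Finset.mem_sdiff.2 ⟨hv, hvU⟩) hvz
    · rintro rfl
      exact hz (hPQ ▸ Finset.mem_union_left _
        (finBall_mono_right (Nat.zero_le _) (Finset.mem_singleton_self _)))
  have k₁ := key x y rfl
  have k₂ := key y x (by rw [hU, Finset.pair_comm])
  rw [← hP, ← hQ] at k₁ k₂
  set D := Finset.univ.filter fun z => G.dist z x ≠ G.dist z y with hD
  have hDc : {z : V | G.dist z x ≠ G.dist z y}.ncard = D.card := by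
    rw [← Set.ncard_coe_finset]; congr 1; ext z; simp [hD]
  rw [hDc]
  have d₁ : Disjoint (P \ Q) (Q \ P) := by
    rw [Finset.disjoint_left]; simp only [Finset.mem_sdiff]; tauto
  have d₂ : Disjoint (P \ Q ∪ Q \ P) (oneSided G U P Q) := by
    rw [Finset.disjoint_left]
    intro z hz hz'
    refine (k₁ z hz').1 ?_
    simp only [Finset.mem_union, Finset.mem_sdiff] at hz ⊢
    tauto
  have d₃ : Disjoint (P \ Q ∪ Q \ P ∪ oneSided G U P Q) (oneSided G U Q P) := by
    rw [Finset.disjoint_left]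
    intro z hz hz'
    rcases Finset.mem_union.1 hz with hz | hz
    · refine (k₂ z hz').1 ?_
      simp only [Finset.mem_union, Finset.mem_sdiff] at hz ⊢
      tauto
    · obtain ⟨-, ⟨a, ha, haz⟩, -⟩ := Finset.mem_filter.1 hz
      obtain ⟨-, -, hb⟩ := Finset.mem_filter.1 hz'
      refine hb a ?_ haz
      simp only [Finset.mem_union, Finset.mem_sdiff] at ha ⊢
      tauto
  rw [← Finset.card_union_of_disjoint d₁, ← Finset.card_union_of_disjoint d₂,
    ← Finset.card_union_of_disjoint d₃]
  have hsub : P \ Q ∪ Q \ P ∪ oneSided G U P Q ∪ oneSided G U Q P ⊆ D ∪ {x, y} := by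
    intro z hz
    by_cases hzx : z = x
    · simp [hzx]
    by_cases hzy : z = y
    · simp [hzy]
    refine Finset.mem_union_left _ (Finset.mem_filter.2 ⟨Finset.mem_univ _, ?_⟩)
    rcases Finset.mem_union.1 hz with hz | hz
    · rcases Finset.mem_union.1 hz with hz | hz
      · rcases Finset.mem_union.1 hz with hz | hz
        · rw [Finset.mem_sdiff] at hz
          exact dist_ne_of_mem_finBall hz.1 hz.2 hzx
        · rw [Finset.mem_sdiff] at hz
          exact (dist_ne_of_mem_finBall hz.1 hz.2 hzy).symm
      · exact (k₁ z hz).2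
    · exact (k₂ z hz).2.symm
  calc _ ≤ (D ∪ {x, y}).card := Finset.card_le_card hsub
    _ ≤ D.card + ({x, y} : Finset V).card := Finset.card_union_le _ _
    _ ≤ D.card + 2 := Nat.add_le_add_left Finset.card_le_two _

/-- The graph whose edges are the pairs whose coin shows heads. -/
def coinGraph (ω : Sym2 V → Bool) : SimpleGraph V := SimpleGraph.fromEdgeSet {e | ω e = true}

omit [Fintype V] in
lemma coinGraph_adj {ω : Sym2 V → Bool} : (coinGraph ω).Adj x y ↔ ω s(x, y) = true ∧ x ≠ y := by
  simp [coinGraph]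

/-- The balls around `A` are determined by the coins on pairs meeting the next smaller ball. -/
lemma finBall_coinGraph_congr {U : Finset V} {m : ℕ} {ω ω' : Sym2 V → Bool}
    (h : ∀ e, (∃ u ∈ U, u ∈ e) → ω e = ω' e) (hU : finBall (coinGraph ω) A m ⊆ U)
    (hj : j ≤ m + 1) : finBall (coinGraph ω) A j = finBall (coinGraph ω') A j := by
  induction j with
  | zero => rfl
  | succ j ih =>
    rw [finBall_succ, finBall_succ, ← ih (by omega)]
    have hsub : finBall (coinGraph ω) A j ⊆ U := (finBall_mono_right (by omega)).trans hU
    ext z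
    simp only [mem_closedNbhd, coinGraph_adj]
    refine or_congr_right (exists_congr fun a => and_congr_right fun ha => ?_)
    rw [h s(a, z) ⟨a, hsub ha, Sym2.mem_mk_left _ _⟩]

end Graph

lemma gnpProb_eq_coinProb (n : ℕ) (p : ℝ) (A : Set (SimpleGraph (Fin n))) :
    gnpProb n p A = coinProb p {ω | coinGraph ω ∈ A} := by
  classical
  have hweight : ∀ G : SimpleGraph (Fin n),
      coinExp p (fun ω => if coinGraph ω = G then (1 : ℝ) else 0) = gnpWeight n p G := by
    intro G
    have h := coinExp_prod (p := p) (fun (e : Sym2 (Fin n)) b =>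
      if e.IsDiag then (1 : ℝ) else if (b = true ↔ e ∈ G.edgeSet) then 1 else 0)
    have h₁ : ∀ ω : Sym2 (Fin n) → Bool, (if coinGraph ω = G then (1 : ℝ) else 0) =
        ∏ e, if e.IsDiag then (1 : ℝ) else if (ω e = true ↔ e ∈ G.edgeSet) then 1 else 0 := by
      intro ω
      split_ifs with hG
      · refine (Finset.prod_eq_one fun e _ => ?_).symm
        split_ifs with h1 h2
        · rfl
        · rfl
        · refine absurd ?_ h2
          rw [← hG, coinGraph, SimpleGraph.edgeSet_fromEdgeSet]
          simp [h1]
      · have : ∃ e : Sym2 (Fin n), ¬ e.IsDiag ∧ ¬ (ω e = true ↔ e ∈ G.edgeSet) := by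
          by_contra! hcon
          refine hG ?_
          ext a b
          rw [coinGraph_adj]
          by_cases hab : a = b
          · simp [hab]
          · rw [hcon s(a, b) (by simpa using hab)]
            simp [hab]
        obtain ⟨e, he, he'⟩ := this
        exact (Finset.prod_eq_zero (Finset.mem_univ e) (by simp only [he, he', if_false])).symm
    simp only [h₁]
    rw [h, gnpWeight]
    have h₂ : ∀ e : Sym2 (Fin n), (p * (if e.IsDiag then (1 : ℝ) else
        if (true = true ↔ e ∈ G.edgeSet) then 1 else 0) + (1 - p) * (if e.IsDiag then (1 : ℝ) else
        if (false = true ↔ e ∈ G.edgeSet) then 1 else 0)) =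
        if e.IsDiag then 1 else if e ∈ G.edgeSet then p else 1 - p := by
      intro e
      by_cases h1 : e.IsDiag <;> by_cases h2 : e ∈ G.edgeSet <;> simp [h1, h2]
    rw [Finset.prod_congr rfl fun e _ => h₂ e, Finset.prod_ite, Finset.prod_const_one, one_mul, Finset.prod_ite, Finset.prod_const,
      Finset.prod_const]
    have hE : ((Finset.univ.filter fun e : Sym2 (Fin n) => ¬ e.IsDiag).filter
        fun e => e ∈ G.edgeSet).card = Nat.card G.edgeSet := by
      rw [Nat.card_eq_fintype_card, Fintype.card_subtype, Finset.filter_filter]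
      congr 1
      ext e
      simp only [Finset.mem_filter, Finset.mem_univ, true_and]
      exact ⟨fun h => h.2, fun h => ⟨G.not_isDiag_of_mem_edgeSet h, h⟩⟩
    have hN := Finset.card_filter_add_card_filter_not
      (s := Finset.univ.filter fun e : Sym2 (Fin n) => ¬ e.IsDiag) (fun e => e ∈ G.edgeSet)
    have hC : (Finset.univ.filter fun e : Sym2 (Fin n) => ¬ e.IsDiag).card = n.choose 2 := by
      rw [← Fintype.card_subtype, Sym2.card_subtype_not_diag, Fintype.card_fin]
    rw [hC, hE] at hN
    rw [hE, ← hN]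
    congr 2
    omega
  rw [gnpProb, tsum_fintype, coinProb]
  have hsum : {ω | coinGraph ω ∈ A}.indicator (1 : (Sym2 (Fin n) → Bool) → ℝ) = fun ω =>
      ∑ G : SimpleGraph (Fin n), A.indicator 1 G * (if coinGraph ω = G then (1 : ℝ) else 0) := by
    ext ω
    simp only [mul_ite, mul_one, mul_zero, Finset.sum_ite_eq, Finset.mem_univ, if_true]
    by_cases h : coinGraph ω ∈ A <;> simp [h]
  rw [hsum, coinExp_sum]
  refine Finset.sum_congr rfl fun G _ => ?_
  rw [coinExp_const_mul, hweight]
  by_cases h : G ∈ A <;> simp [h]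

section Star

variable {V : Type*} {p : ℝ} {A B : Finset V}

/-- The coins on the pairs joining `z` to `A`. -/
def starCoins (A : Finset V) (z : V) : Set (Sym2 V) := {e | ∃ a ∈ A, e = s(z, a)}

/-- The event that `z` is joined to some vertex of `A` and to no vertex of `B`. -/
def starEvent (A B : Finset V) (z : V) : Set (Sym2 V → Bool) :=
  {ω | (∃ a ∈ A, ω s(z, a) = true) ∧ ∀ b ∈ B, ω s(z, b) = false}

lemma dependsOn_starEvent [DecidableEq V] (A B : Finset V) (z : V) :
    DependsOn (fun ω => ω ∈ starEvent A B z) (starCoins (A ∪ B) z) := by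
  intro ω ω' h
  have hA : ∀ a ∈ A, ω s(z, a) = ω' s(z, a) := fun a ha =>
    h _ ⟨a, Finset.mem_union_left _ ha, rfl⟩
  have hB : ∀ a ∈ B, ω s(z, a) = ω' s(z, a) := fun a ha =>
    h _ ⟨a, Finset.mem_union_right _ ha, rfl⟩
  simp only [starEvent, Set.mem_ofPred_eq, eq_iff_iff]
  refine and_congr (exists_congr fun a => and_congr_right fun ha => by rw [hA a ha])
    (forall₂_congr fun b hb => by rw [hB b hb])

lemma pairwiseDisjoint_starCoins {Z : Finset V} (h : Disjoint Z A) :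
    (Z : Set V).PairwiseDisjoint (starCoins A) := by
  intro z hz z' hz' hne
  rw [Function.onFun, Set.disjoint_left]
  rintro e ⟨a, ha, rfl⟩ ⟨a', ha', he⟩
  rcases Sym2.eq_iff.1 he with ⟨rfl, -⟩ | ⟨rfl, -⟩
  · exact hne rfl
  · exact Finset.disjoint_left.1 h hz ha'

lemma coinProb_starEvent [Fintype V] [DecidableEq V] (hAB : Disjoint A B) (z : V) :
    coinProb p (starEvent A B z) = (1 - p) ^ B.card * (1 - (1 - p) ^ A.card) := by
  have hinj : Function.Injective fun a : V => s(z, a) := fun a b h => Sym2.congr_right.1 h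
  have h := coinProb_all_false_not (p := p) ((Finset.disjoint_image hinj).2 hAB)
  rw [Finset.card_image_of_injective _ hinj, Finset.card_image_of_injective _ hinj] at h
  rw [← h]
  congr 1
  ext ω
  simp [starEvent]

end Star

section Expansion

variable {V : Type*} [Fintype V] [DecidableEq V] {p : ℝ}

open Classical in
lemma card_closedNbhd_coinGraph (ω : Sym2 V → Bool) (A : Finset V) :
    (closedNbhd (coinGraph ω) A).card =
      A.card + (Aᶜ.filter fun z => ω ∈ starEvent A ∅ z).card := by
  rw [← Finset.card_union_of_disjoint]
  · congr 1
    ext z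
    simp only [mem_closedNbhd, coinGraph_adj, Finset.mem_union, Finset.mem_filter,
      Finset.mem_compl, starEvent, Set.mem_ofPred_eq, Finset.notMem_empty, IsEmpty.forall_iff,
      implies_true, and_true]
    constructor
    · rintro (h | ⟨a, ha, h, -⟩)
      · exact Or.inl h
      · by_cases hz : z ∈ A
        · exact Or.inl hz
        · exact Or.inr ⟨hz, a, ha, Sym2.eq_swap ▸ h⟩
    · rintro (h | ⟨hz, a, ha, h⟩)
      · exact Or.inl h
      · exact Or.inr ⟨a, ha, Sym2.eq_swap ▸ h, fun h' => hz (h' ▸ ha)⟩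
  · rw [Finset.disjoint_left]
    intro z hz hz'
    exact Finset.mem_compl.1 (Finset.mem_filter.1 hz').1 hz

lemma coinProb_exists_nonempty_le (hp : 0 ≤ p) (hp1 : p ≤ 1) (S : Finset V → Set (Sym2 V → Bool))
    {ρ : ℝ} (hS : ∀ A : Finset V, coinProb p (S A) ≤ ρ ^ A.card) :
    coinProb p {ω | ∃ A : Finset V, A.Nonempty ∧ ω ∈ S A} ≤ (1 + ρ) ^ Fintype.card V - 1 := by
  have h := coinProb_exists_le hp hp1 (Finset.univ.erase (∅ : Finset V)) S
  have h' : ∑ A : Finset V, ρ ^ A.card = (1 + ρ) ^ Fintype.card V := by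
    have := Fintype.sum_pow_mul_eq_add_pow V ρ 1
    simpa [add_comm] using this
  have hsum := Finset.add_sum_erase Finset.univ (fun A : Finset V => ρ ^ A.card)
    (Finset.mem_univ ∅)
  rw [h', Finset.card_empty, pow_zero] at hsum
  calc _ ≤ coinProb p {ω | ∃ A ∈ Finset.univ.erase (∅ : Finset V), ω ∈ S A} := by
        refine coinProb_mono hp hp1 ?_
        rintro ω ⟨A, hA, hω⟩
        exact ⟨A, Finset.mem_erase.2 ⟨hA.ne_empty, Finset.mem_univ _⟩, hω⟩
    _ ≤ ∑ A ∈ Finset.univ.erase (∅ : Finset V), ρ ^ A.card :=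
        h.trans (Finset.sum_le_sum fun A _ => hS A)
    _ = _ := by linarith

/-- It is unlikely that some closed neighbourhood is much larger than expected. -/
lemma coinProb_exists_closedNbhd_ge (hp : 0 ≤ p) (hp1 : p ≤ 1) {ε ρ : ℝ} (hε : 0 ≤ ε)
    (hε1 : ε ≤ 1) (hρ : Real.exp (-(ε ^ 2 * (p * Fintype.card V) / 4)) ≤ ρ) :
    coinProb p {ω | ∃ A : Finset V, A.Nonempty ∧ A.card + (1 + ε) * (A.card * (p * Fintype.card V)) ≤
      (closedNbhd (coinGraph ω) A).card} ≤ (1 + ρ) ^ Fintype.card V - 1 := by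
  classical
  refine coinProb_exists_nonempty_le hp hp1 (fun A => {ω | A.card + (1 + ε) *
    (A.card * (p * Fintype.card V)) ≤ (closedNbhd (coinGraph ω) A).card}) fun A => ?_
  have h := coinProb_upper_tail hp hp1 Aᶜ _ (starEvent A ∅)
    (fun z _ => dependsOn_starEvent A ∅ z)
    (pairwiseDisjoint_starCoins (by simpa using disjoint_compl_left))
    (fun z _ => coinProb_starEvent (Finset.disjoint_empty_right A) z)
    (M := A.card * (p * Fintype.card V)) (by positivity) ?_ hε hε1
  · calc _ ≤ _ := coinProb_mono hp hp1 fun ω hω => ?_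
      _ ≤ _ := h
      _ = Real.exp (-(ε ^ 2 * (p * Fintype.card V) / 4)) ^ A.card := by
        rw [← Real.exp_nat_mul]; ring_nf
      _ ≤ _ := pow_le_pow_left₀ (Real.exp_pos _).le hρ _
    rw [Set.mem_ofPred_eq, card_closedNbhd_coinGraph] at hω
    rw [Set.mem_ofPred_eq]
    push_cast at hω
    linarith
  · have hb := one_add_mul_le_pow (show (-2 : ℝ) ≤ -p by linarith) A.card
    have hq : 0 ≤ (1 - p) ^ A.card := pow_nonneg (by linarith) _
    have hc : ((Aᶜ : Finset V).card : ℝ) ≤ Fintype.card V := by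
      exact_mod_cast Finset.card_le_univ _
    have hq1 : 0 ≤ 1 - (1 - p) ^ A.card :=
      sub_nonneg.2 (pow_le_one₀ (by linarith) (by linarith))
    calc ((Aᶜ : Finset V).card : ℝ) * ((1 - p) ^ (∅ : Finset V).card * (1 - (1 - p) ^ A.card))
        ≤ Fintype.card V * (A.card * p) := by
          refine mul_le_mul hc ?_ (by simpa using hq1) (by positivity)
          rw [Finset.card_empty, pow_zero, one_mul]
          rw [← sub_eq_add_neg] at hb
          linarith
      _ = _ := by ring

lemma le_one_sub_one_sub_pow (hp : 0 ≤ p) (hp1 : p ≤ 1) {η : ℝ} {k : ℕ} (hk : k * p ≤ η) :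
    (1 - η) * (k * p) ≤ 1 - (1 - p) ^ k := by
  have h₀ : (0 : ℝ) ≤ k * p := by positivity
  have h₁ : (1 - p) ^ k ≤ Real.exp (-(k * p)) := by
    rw [show -(k * p) = k * (-p) by ring, Real.exp_nat_mul]
    exact pow_le_pow_left₀ (by linarith) (Real.one_sub_le_exp_neg p) _
  have h₂ : Real.exp (-(k * p)) * (1 + k * p) ≤ 1 := by
    have := Real.add_one_le_exp (k * p)
    calc _ ≤ Real.exp (-(k * p)) * Real.exp (k * p) :=
          mul_le_mul_of_nonneg_left (by linarith) (Real.exp_pos _).le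
      _ = 1 := by rw [← Real.exp_add]; simp
  have h₃ := Real.one_sub_le_exp_neg (k * p)
  nlinarith [mul_nonneg h₀ (sub_nonneg.2 h₃), mul_nonneg h₀ (sub_nonneg.2 hk)]

/-- It is unlikely that some closed neighbourhood is much smaller than expected. -/
lemma coinProb_exists_closedNbhd_le (hp : 0 ≤ p) (hp1 : p ≤ 1) {η ρ : ℝ} (hη : 0 ≤ η)
    (hη1 : η ≤ 1) (hρ : Real.exp (-(η ^ 2 * ((1 - η) ^ 2 * (p * Fintype.card V)) / 4)) ≤ ρ) :
    coinProb p {ω | ∃ A : Finset V, A.Nonempty ∧ A.card * p ≤ η ∧ A.card ≤ η * Fintype.card V ∧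
      (closedNbhd (coinGraph ω) A).card ≤ (1 - η) ^ 3 * (A.card * (p * Fintype.card V))} ≤
        (1 + ρ) ^ Fintype.card V - 1 := by
  classical
  refine coinProb_exists_nonempty_le hp hp1 (fun A => {ω | A.card * p ≤ η ∧
    A.card ≤ η * Fintype.card V ∧ (closedNbhd (coinGraph ω) A).card ≤
      (1 - η) ^ 3 * (A.card * (p * Fintype.card V))}) fun A => ?_
  have hρ0 : 0 ≤ ρ := (Real.exp_pos _).le.trans hρ
  by_cases hA : A.card * p ≤ η ∧ (A.card : ℝ) ≤ η * Fintype.card V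
  swap
  · refine (le_of_eq ?_).trans (pow_nonneg hρ0 A.card)
    have : {ω | A.card * p ≤ η ∧ A.card ≤ η * Fintype.card V ∧
        (closedNbhd (coinGraph ω) A).card ≤ (1 - η) ^ 3 * (A.card * (p * Fintype.card V))} = ∅ := by
      ext ω
      simp only [Set.mem_ofPred_eq, Set.mem_empty_iff_false, iff_false]
      tauto
    rw [this]
    simp [coinProb, coinExp]
  have h := coinProb_lower_tail hp hp1 Aᶜ _ (starEvent A ∅)
    (fun z _ => dependsOn_starEvent A ∅ z)
    (pairwiseDisjoint_starCoins (by simpa using disjoint_compl_left))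
    (fun z _ => coinProb_starEvent (Finset.disjoint_empty_right A) z)
    (M := (1 - η) ^ 2 * (A.card * (p * Fintype.card V))) (by positivity) ?_ hη hη1
  · calc _ ≤ _ := coinProb_mono hp hp1 fun ω hω => ?_
      _ ≤ _ := h
      _ = Real.exp (-(η ^ 2 * ((1 - η) ^ 2 * (p * Fintype.card V)) / 4)) ^ A.card := by
        rw [← Real.exp_nat_mul]; ring_nf
      _ ≤ _ := pow_le_pow_left₀ (Real.exp_pos _).le hρ _
    obtain ⟨-, -, hω⟩ := hω
    rw [card_closedNbhd_coinGraph] at hω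
    rw [Set.mem_ofPred_eq]
    push_cast at hω
    have : (0 : ℝ) ≤ A.card := by positivity
    nlinarith
  · have hb := le_one_sub_one_sub_pow hp hp1 hA.1
    have hc : ((Aᶜ : Finset V).card : ℝ) = Fintype.card V - A.card := by
      rw [Finset.card_compl, Nat.cast_sub (Finset.card_le_univ _)]
    rw [Finset.card_empty, pow_zero, one_mul, hc]
    have hV : (0 : ℝ) ≤ (1 - η) * Fintype.card V := mul_nonneg (by linarith) (by positivity)
    calc (1 - η) ^ 2 * (A.card * (p * Fintype.card V)) =
        ((1 - η) * Fintype.card V) * ((1 - η) * (A.card * p)) := by ring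
      _ ≤ _ := mul_le_mul (by linarith) hb
        (mul_nonneg (by linarith) (by positivity)) (by linarith [hA.2])

lemma coinProb_oneSided_le (hp : 0 ≤ p) (hp1 : p ≤ 1) (x y : V) (m : ℕ) {a₀ b₀ w₀ M η : ℝ}
    (hM0 : 0 ≤ M) (hη : 0 ≤ η) (hη1 : η ≤ 1)
    (hM : ∀ a b k : ℕ, a₀ ≤ a → b ≤ b₀ → Fintype.card V - w₀ ≤ k →
      M ≤ k * ((1 - p) ^ b * (1 - (1 - p) ^ a))) :
    coinProb p {ω |
      a₀ ≤ (finBall (coinGraph ω) {x} (m + 1) \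
        (finBall (coinGraph ω) {y} (m + 1) ∪ finBall (coinGraph ω) {x, y} m)).card ∧
      (finBall (coinGraph ω) {y} (m + 1)).card ≤ b₀ ∧
      (finBall (coinGraph ω) {x, y} (m + 1)).card ≤ w₀ ∧
      (oneSided (coinGraph ω) (finBall (coinGraph ω) {x, y} m) (finBall (coinGraph ω) {x} (m + 1))
        (finBall (coinGraph ω) {y} (m + 1))).card ≤ (1 - η) * M} ≤
      Real.exp (-(η ^ 2 * M / 4)) := by
  classical
  let σ : (Sym2 V → Bool) → Finset V × Finset V × Finset V := fun ω =>
    (finBall (coinGraph ω) {x, y} m, finBall (coinGraph ω) {x} (m + 1),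
      finBall (coinGraph ω) {y} (m + 1))
  let X : Finset V × Finset V × Finset V → Set (Sym2 V → Bool) := fun s =>
    {ω | (s.1 ⊆ s.2.1 ∪ s.2.2 ∧ a₀ ≤ (s.2.1 \ (s.2.2 ∪ s.1)).card ∧ s.2.2.card ≤ b₀ ∧
      (s.2.1 ∪ s.2.2).card ≤ w₀) ∧ ((s.2.1 ∪ s.2.2)ᶜ.filter fun z =>
        ω ∈ starEvent (s.2.1 \ (s.2.2 ∪ s.1)) (s.2.2 \ s.1) z).card ≤ (1 - η) * M}
  let R : Finset V × Finset V × Finset V → Set (Sym2 V) := fun s => {e | ∃ u ∈ s.1, u ∈ e}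
  let T : Finset V × Finset V × Finset V → Set (Sym2 V) := fun s =>
    ⋃ z ∈ (s.2.1 ∪ s.2.2)ᶜ, starCoins (s.2.1 \ (s.2.2 ∪ s.1) ∪ s.2.2 \ s.1) z
  have hdec := coinProb_decouple hp hp1 σ X R T (β := Real.exp (-(η ^ 2 * M / 4))) ?_ ?_ ?_ ?_
  · refine (coinProb_mono hp hp1 ?_).trans hdec
    rintro ω ⟨h₁, h₂, h₃, h₄⟩
    have hPQ : finBall (coinGraph ω) {x} (m + 1) ∪ finBall (coinGraph ω) {y} (m + 1) =
        finBall (coinGraph ω) {x, y} (m + 1) := by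
      rw [← finBall_union]; rfl
    refine ⟨⟨?_, h₁, h₂, ?_⟩, ?_⟩
    · simp only [σ, hPQ]
      exact finBall_mono_right (Nat.le_succ m)
    · simpa only [σ, hPQ] using h₃
    · refine le_trans ?_ h₄
      refine Nat.cast_le.2 (Finset.card_le_card fun z hz => ?_)
      rw [Finset.mem_filter] at hz
      obtain ⟨hz, ⟨a, ha, haz⟩, hb⟩ := hz
      simp only [σ, Finset.mem_compl, Finset.mem_union, Finset.mem_sdiff, not_or] at hz ha hb
      refine mem_oneSided.2 ⟨hz.1, hz.2, ⟨a, ha.1, ha.2.1, ha.2.2, coinGraph_adj.2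
        ⟨Sym2.eq_swap ▸ haz, fun h => hz.1 (h ▸ ha.1)⟩⟩, fun b hbQ hbU hadj => ?_⟩
      have h₅ := hb b ⟨hbQ, hbU⟩
      rw [Sym2.eq_swap, (coinGraph_adj.1 hadj).1] at h₅
      exact absurd h₅ (by decide)
  · have himp : ∀ s (ω ω' : Sym2 V → Bool), (∀ e ∈ R s, ω e = ω' e) → σ ω = s → σ ω' = s := by
      rintro _ ω ω' h rfl
      have hx : finBall (coinGraph ω) {x} m ⊆ finBall (coinGraph ω) {x, y} m :=
        finBall_mono_left (by simp)
      have hy : finBall (coinGraph ω) {y} m ⊆ finBall (coinGraph ω) {x, y} m :=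
        finBall_mono_left (by simp)
      simp only [σ]
      rw [finBall_coinGraph_congr h (Finset.Subset.refl _) (Nat.le_succ m),
        finBall_coinGraph_congr h hx le_rfl, finBall_coinGraph_congr h hy le_rfl]
    exact fun s ω ω' h => propext ⟨himp s ω ω' h, himp s ω' ω fun e he => (h e he).symm⟩
  · intro s ω ω' h
    have h' : ∀ z ∈ (s.2.1 ∪ s.2.2)ᶜ, (ω ∈ starEvent (s.2.1 \ (s.2.2 ∪ s.1)) (s.2.2 \ s.1) z) =
        (ω' ∈ starEvent (s.2.1 \ (s.2.2 ∪ s.1)) (s.2.2 \ s.1) z) := fun z hz =>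
      dependsOn_starEvent _ _ z fun e he => h e (Set.mem_biUnion (by exact hz) he)
    simp only [X, Set.mem_ofPred_eq]
    rw [Finset.filter_congr fun z hz => Iff.of_eq (h' z hz)]
  · rintro s ⟨ω, ⟨hs, -⟩, -⟩
    rw [Set.disjoint_left]
    rintro e ⟨u, hu, hue⟩ he
    simp only [T, Set.mem_iUnion] at he
    obtain ⟨z, hz, a, ha, rfl⟩ := he
    rcases Sym2.mem_iff.1 hue with rfl | rfl
    · exact Finset.mem_compl.1 hz (hs hu)
    · simp only [Finset.mem_union, Finset.mem_sdiff] at ha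
      tauto
  · intro s
    by_cases hs : s.1 ⊆ s.2.1 ∪ s.2.2 ∧ a₀ ≤ (s.2.1 \ (s.2.2 ∪ s.1)).card ∧ s.2.2.card ≤ b₀ ∧
      (s.2.1 ∪ s.2.2).card ≤ w₀
    swap
    · have : X s = ∅ := by
        ext ω
        simp only [X, Set.mem_ofPred_eq, Set.mem_empty_iff_false, iff_false]
        exact fun h => hs h.1
      rw [this]
      simpa [coinProb, coinExp] using (Real.exp_pos _).le
    obtain ⟨-, ha, hb, hw⟩ := hs
    have hdisj : Disjoint (s.2.1 ∪ s.2.2)ᶜ (s.2.1 \ (s.2.2 ∪ s.1) ∪ s.2.2 \ s.1) := by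
      rw [Finset.disjoint_left]
      simp only [Finset.mem_compl, Finset.mem_union, Finset.mem_sdiff]
      tauto
    have hAB : Disjoint (s.2.1 \ (s.2.2 ∪ s.1)) (s.2.2 \ s.1) := by
      rw [Finset.disjoint_left]
      simp only [Finset.mem_union, Finset.mem_sdiff]
      tauto
    refine (coinProb_mono hp hp1 ?_).trans (coinProb_lower_tail hp hp1 (s.2.1 ∪ s.2.2)ᶜ _
      (starEvent (s.2.1 \ (s.2.2 ∪ s.1)) (s.2.2 \ s.1))
      (fun z _ => dependsOn_starEvent _ _ z) (pairwiseDisjoint_starCoins hdisj)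
      (fun z _ => coinProb_starEvent hAB z) hM0 ?_ hη hη1)
    · exact fun ω hω => hω.2
    · refine hM _ _ _ ha ?_ ?_
      · refine le_trans ?_ hb
        exact_mod_cast Finset.card_le_card Finset.sdiff_subset
      · rw [Finset.card_compl, Nat.cast_sub (Finset.card_le_univ _)]
        linarith

end Expansion

section Growth

variable {V : Type*} [Fintype V] {G : SimpleGraph V} {u l K : ℝ} {A : Finset V}

lemma finBall_nonempty (hA : A.Nonempty) (j : ℕ) : (finBall G A j).Nonempty :=
  hA.mono (finBall_mono_right (Nat.zero_le j))

lemma card_finBall_le (hu0 : 0 ≤ u)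
    (hu : ∀ A : Finset V, A.Nonempty → ((closedNbhd G A).card : ℝ) ≤ u * A.card)
    (hA : A.Nonempty) (j : ℕ) : ((finBall G A j).card : ℝ) ≤ u ^ j * A.card := by
  induction j with
  | zero => simp
  | succ j ih =>
    rw [finBall_succ, pow_succ', mul_assoc]
    exact (hu _ (finBall_nonempty hA j)).trans (mul_le_mul_of_nonneg_left ih hu0)

lemma le_card_finBall (hu1 : 1 ≤ u) (hl0 : 0 ≤ l)
    (hu : ∀ A : Finset V, A.Nonempty → ((closedNbhd G A).card : ℝ) ≤ u * A.card)
    (hl : ∀ A : Finset V, A.Nonempty → (A.card : ℝ) ≤ K → l * A.card ≤ (closedNbhd G A).card)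
    (hA : A.Nonempty) {m : ℕ} (hK : u ^ m * A.card ≤ K) {j : ℕ} (hj : j ≤ m + 1) :
    l ^ j * A.card ≤ (finBall G A j).card := by
  induction j with
  | zero => simp
  | succ j ih =>
    rw [finBall_succ, pow_succ', mul_assoc]
    refine (mul_le_mul_of_nonneg_left (ih (by omega)) hl0).trans
      (hl _ (finBall_nonempty hA j) ?_)
    refine (card_finBall_le (by linarith) hu hA j).trans (le_trans ?_ hK)
    exact mul_le_mul_of_nonneg_right (pow_le_pow_right₀ hu1 (by omega)) (by positivity)

/-- In a graph with regular expansion, balls around distinct vertices differ considerably. -/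
lemma card_ball_bounds [DecidableEq V] (hu1 : 1 ≤ u) (hl0 : 0 ≤ l)
    (hu : ∀ A : Finset V, A.Nonempty → ((closedNbhd G A).card : ℝ) ≤ u * A.card)
    (hl : ∀ A : Finset V, A.Nonempty → (A.card : ℝ) ≤ K → l * A.card ≤ (closedNbhd G A).card)
    {m : ℕ} (hK : 2 * u ^ m ≤ K) {x y : V} (hxy : x ≠ y) :
    2 * l ^ (m + 1) - u ^ (m + 1) ≤
      (finBall G {x} (m + 1) \ finBall G {y} (m + 1)).card ∧
    2 * l ^ (m + 1) - u ^ (m + 1) - 2 * u ^ m ≤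
      (finBall G {x} (m + 1) \ (finBall G {y} (m + 1) ∪ finBall G {x, y} m)).card ∧
    (finBall G {y} (m + 1)).card ≤ u ^ (m + 1) ∧
    (finBall G {x, y} (m + 1)).card ≤ 2 * u ^ (m + 1) := by
  have hu0 : 0 ≤ u := by linarith
  have hc : ((({x, y} : Finset V).card : ℕ) : ℝ) = 2 := by rw [Finset.card_pair hxy]; norm_num
  have hne : ({x, y} : Finset V).Nonempty := ⟨x, by simp⟩
  have h₁ := le_card_finBall hu1 hl0 hu hl hne (m := m) (by rw [hc]; linarith) le_rfl
  have h₂ := card_finBall_le hu0 hu hne m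
  have h₃ := card_finBall_le hu0 hu hne (m + 1)
  have h₄ := card_finBall_le hu0 hu (Finset.singleton_nonempty y) (m + 1)
  rw [hc] at h₁ h₂ h₃
  rw [Finset.card_singleton, Nat.cast_one, mul_one] at h₄
  have hPQ : finBall G {x} (m + 1) ∪ finBall G {y} (m + 1) = finBall G {x, y} (m + 1) := by
    rw [← finBall_union]; rfl
  have h₅ : (finBall G {x, y} (m + 1)).card ≤
      (finBall G {x} (m + 1) \ finBall G {y} (m + 1)).card + (finBall G {y} (m + 1)).card := by
    rw [← hPQ, ← Finset.sdiff_union_self_eq_union]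
    exact Finset.card_union_le _ _
  have h₆ : (finBall G {x} (m + 1) \ finBall G {y} (m + 1)).card ≤
      (finBall G {x} (m + 1) \ (finBall G {y} (m + 1) ∪ finBall G {x, y} m)).card +
        (finBall G {x, y} m).card := by
    rw [← Finset.sup_eq_union, ← sdiff_sdiff_left]
    exact Finset.card_le_card_sdiff_add_card
  have h₅' : ((finBall G {x, y} (m + 1)).card : ℝ) ≤
      (finBall G {x} (m + 1) \ finBall G {y} (m + 1)).card + (finBall G {y} (m + 1)).card := by
    exact_mod_cast h₅
  have h₆' : ((finBall G {x} (m + 1) \ finBall G {y} (m + 1)).card : ℝ) ≤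
      (finBall G {x} (m + 1) \ (finBall G {y} (m + 1) ∪ finBall G {x, y} m)).card +
        (finBall G {x, y} m).card := by
    exact_mod_cast h₆
  exact ⟨by linarith, by linarith, h₄, by linarith⟩

end Growth

/-- A quantitative lower bound on the number of vertices distinguishing two given vertices. -/
lemma le_gnpProb_distinguishing {n m : ℕ} {p u l K M ε η ρ β t : ℝ} (hp : 0 ≤ p) (hp1 : p ≤ 1)
    (hε : 0 ≤ ε) (hε1 : ε ≤ 1) (hη : 0 ≤ η) (hη1 : η ≤ 1)
    (hρ : Real.exp (-(ε ^ 2 * (p * n) / 4)) ≤ ρ)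
    (hρ' : Real.exp (-(η ^ 2 * ((1 - η) ^ 2 * (p * n)) / 4)) ≤ ρ)
    (hu : 1 + (1 + ε) * (p * n) ≤ u) (hl0 : 0 ≤ l) (hl : l ≤ (1 - η) ^ 3 * (p * n))
    (hKp : K * p ≤ η) (hKn : K ≤ η * n) (hK : 2 * u ^ m ≤ K) (hM0 : 0 ≤ M) (hβ : 0 ≤ β)
    (hMβ : M ≠ 0 → Real.exp (-(η ^ 2 * M / 4)) ≤ β ∧ ∀ a b k : ℕ,
      2 * l ^ (m + 1) - u ^ (m + 1) - 2 * u ^ m ≤ a → b ≤ u ^ (m + 1) → n - 2 * u ^ (m + 1) ≤ k →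
      M ≤ k * ((1 - p) ^ b * (1 - (1 - p) ^ a)))
    (ht : t ≤ 2 * (2 * l ^ (m + 1) - u ^ (m + 1)) - 2 + 2 * ((1 - η) * M)) :
    1 - (2 * ((1 + ρ) ^ n - 1) + n ^ 2 * β) ≤ gnpProb n p {G | ∀ x y : Fin n, x ≠ y →
      t ≤ ({z : Fin n | G.dist z x ≠ G.dist z y}.ncard : ℝ)} := by
  rw [gnpProb_eq_coinProb]
  have hpn : 0 ≤ p * n := by positivity
  have hu1 : 1 ≤ u := by nlinarith
  set B₁ : Set (Sym2 (Fin n) → Bool) := {ω | ∃ A : Finset (Fin n), A.Nonempty ∧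
    A.card + (1 + ε) * (A.card * (p * n)) ≤ (closedNbhd (coinGraph ω) A).card} with hB₁
  set B₂ : Set (Sym2 (Fin n) → Bool) := {ω | ∃ A : Finset (Fin n), A.Nonempty ∧ A.card * p ≤ η ∧
    A.card ≤ η * n ∧ (closedNbhd (coinGraph ω) A).card ≤
      (1 - η) ^ 3 * (A.card * (p * n))} with hB₂
  let E : Fin n × Fin n → Set (Sym2 (Fin n) → Bool) := fun xy => {ω | M ≠ 0 ∧
      2 * l ^ (m + 1) - u ^ (m + 1) - 2 * u ^ m ≤ (finBall (coinGraph ω) {xy.1} (m + 1) \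
        (finBall (coinGraph ω) {xy.2} (m + 1) ∪ finBall (coinGraph ω) {xy.1, xy.2} m)).card ∧
      (finBall (coinGraph ω) {xy.2} (m + 1)).card ≤ u ^ (m + 1) ∧
      (finBall (coinGraph ω) {xy.1, xy.2} (m + 1)).card ≤ 2 * u ^ (m + 1) ∧
      (oneSided (coinGraph ω) (finBall (coinGraph ω) {xy.1, xy.2} m)
        (finBall (coinGraph ω) {xy.1} (m + 1)) (finBall (coinGraph ω) {xy.2} (m + 1))).card ≤
          (1 - η) * M}
  set B₃ : Set (Sym2 (Fin n) → Bool) := {ω | ∃ xy ∈ (Finset.univ : Finset (Fin n × Fin n)),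
    ω ∈ E xy} with hB₃
  have h₁ : coinProb p B₁ ≤ (1 + ρ) ^ n - 1 := by
    have := coinProb_exists_closedNbhd_ge (V := Fin n) hp hp1 hε hε1 (ρ := ρ) (by simpa using hρ)
    simpa using this
  have h₂ : coinProb p B₂ ≤ (1 + ρ) ^ n - 1 := by
    have := coinProb_exists_closedNbhd_le (V := Fin n) hp hp1 hη hη1 (ρ := ρ) (by simpa using hρ')
    simpa using this
  have h₃ : coinProb p B₃ ≤ n ^ 2 * β := by
    refine (coinProb_exists_le hp hp1 _ E).trans ?_
    have hE : ∀ xy ∈ (Finset.univ : Finset (Fin n × Fin n)), coinProb p (E xy) ≤ β := by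
      intro xy _
      by_cases hM : M = 0
      · have : E xy = ∅ := by ext ω; simp [E, hM]
        rw [this]
        simpa [coinProb, coinExp] using hβ
      · obtain ⟨hexp, hM'⟩ := hMβ hM
        refine le_trans (coinProb_mono hp hp1 fun ω hω => hω.2) ((coinProb_oneSided_le hp hp1
          xy.1 xy.2 m hM0 hη hη1 (by simpa using hM')).trans hexp)
    refine (Finset.sum_le_sum hE).trans (le_of_eq ?_)
    simp [sq]
  have hunion : coinProb p (B₁ ∪ B₂ ∪ B₃) ≤ 2 * ((1 + ρ) ^ n - 1) + n ^ 2 * β := by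
    have h₄ := coinProb_union_le hp hp1 (B₁ ∪ B₂) B₃
    have h₅ := coinProb_union_le hp hp1 B₁ B₂
    linarith
  have hcompl := coinProb_compl (p := p) (B₁ ∪ B₂ ∪ B₃)
  refine le_trans (by linarith) (coinProb_mono hp hp1 (S := (B₁ ∪ B₂ ∪ B₃)ᶜ) ?_)
  intro ω hω
  simp only [Set.mem_compl_iff, Set.mem_union, not_or] at hω
  obtain ⟨⟨hω₁, hω₂⟩, hω₃⟩ := hω
  have hup : ∀ A : Finset (Fin n), A.Nonempty →
      ((closedNbhd (coinGraph ω) A).card : ℝ) ≤ u * A.card := by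
    intro A hA
    by_contra! hcon
    refine hω₁ ⟨A, hA, le_trans ?_ hcon.le⟩
    have := mul_le_mul_of_nonneg_right hu (Nat.cast_nonneg (α := ℝ) A.card)
    linarith
  have hlow : ∀ A : Finset (Fin n), A.Nonempty → (A.card : ℝ) ≤ K →
      l * A.card ≤ (closedNbhd (coinGraph ω) A).card := by
    intro A hA hAK
    by_contra! hcon
    refine hω₂ ⟨A, hA, le_trans (mul_le_mul_of_nonneg_right hAK hp) hKp, hAK.trans hKn,
      hcon.le.trans ?_⟩
    have := mul_le_mul_of_nonneg_right hl (Nat.cast_nonneg (α := ℝ) A.card)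
    linarith
  have hone : ∀ x y : Fin n, x ≠ y → (1 - η) * M ≤ (oneSided (coinGraph ω)
      (finBall (coinGraph ω) {x, y} m) (finBall (coinGraph ω) {x} (m + 1))
      (finBall (coinGraph ω) {y} (m + 1))).card := by
    intro x y hxy
    by_cases hM : M = 0
    · simp [hM]
    by_contra! hcon
    obtain ⟨-, b₁, b₂, b₃⟩ := card_ball_bounds hu1 hl0 hup hlow hK hxy
    exact hω₃ ⟨(x, y), Finset.mem_univ _, hM, b₁, b₂, b₃, hcon.le⟩
  intro x y hxy
  have c₁ := card_distinguishing_ge (coinGraph ω) x y m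
  have c₂ := (card_ball_bounds hu1 hl0 hup hlow hK hxy).1
  have c₃ := (card_ball_bounds hu1 hl0 hup hlow hK hxy.symm).1
  have c₄ := hone x y hxy
  have c₅ := hone y x hxy.symm
  rw [Finset.pair_comm] at c₅
  have c₁' := (Nat.cast_le (α := ℝ)).2 c₁
  push_cast at c₁'
  linarith

section Numerics

lemma one_add_pow_le_one_add_two_mul {x : ℝ} (hx : 0 ≤ x) {k : ℕ} (hk : k * x ≤ 1) :
    (1 + x) ^ k ≤ 1 + 2 * (k * x) := by
  have h₁ : (1 + x) ^ k ≤ Real.exp (k * x) := by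
    rw [Real.exp_nat_mul]
    exact pow_le_pow_left₀ (by linarith) (by linarith [Real.add_one_le_exp x]) k
  have h₀ : 0 ≤ k * x := by positivity
  have h₂ := (abs_le.1 (Real.abs_exp_sub_one_le (x := k * x) (by rwa [abs_of_nonneg h₀]))).2
  rw [abs_of_nonneg h₀] at h₂
  linarith

lemma exp_neg_le_one_sub {p : ℝ} (hp : 0 ≤ p) (hp2 : p ≤ 1 / 2) :
    Real.exp (-(p * (1 + 2 * p))) ≤ 1 - p := by
  have h₁ : (0 : ℝ) < 1 - p := by linarith
  rw [Real.exp_neg, inv_le_comm₀ (Real.exp_pos _) h₁]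
  refine le_trans ?_ (Real.add_one_le_exp _)
  rw [inv_le_iff_one_le_mul₀ h₁]
  nlinarith [mul_nonneg hp hp, mul_nonneg (mul_nonneg hp hp) (by linarith : 0 ≤ 1 / 2 - p)]

lemma exp_neg_mul_le {s c : ℝ} (hs : 0 ≤ s) (hs1 : s ≤ 1) :
    Real.exp (-(s * c)) ≤ s * Real.exp (-c) + (1 - s) := by
  have := convexOn_exp.2 (Set.mem_univ (-c)) (Set.mem_univ 0) hs (by linarith : 0 ≤ 1 - s)
    (by ring)
  simpa using this

/-- If `p * D = (1 + o(1)) * c`, then `(1 - p) ^ b` is at least about `exp (-c)`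
for `b` close to `D`. -/
lemma exp_neg_mul_le_one_sub_pow {p c t h D : ℝ} {b : ℕ} (hp : 0 ≤ p) (hpt : 2 * p ≤ t)
    (ht : t ≤ 1 / 50) (hc : 0 ≤ c) (hcL : t * c ≤ h) (hD : p * D ≤ (1 + t) * c)
    (hb : b ≤ (1 + 4 * t) * D) : Real.exp (-c) * (1 - 8 * h) ≤ (1 - p) ^ b := by
  have ht0 : 0 ≤ t := by linarith
  have h₁ : Real.exp (-(p * (1 + 2 * p) * b)) ≤ (1 - p) ^ b := by
    rw [← neg_mul, mul_comm, Real.exp_nat_mul]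
    exact pow_le_pow_left₀ (Real.exp_pos _).le (exp_neg_le_one_sub hp (by linarith)) b
  refine le_trans ?_ h₁
  have h₂ : p * b ≤ (1 + 4 * t) * ((1 + t) * c) := by
    calc p * b ≤ p * ((1 + 4 * t) * D) := by gcongr
      _ = (1 + 4 * t) * (p * D) := by ring
      _ ≤ _ := by gcongr
  have h₃ : p * (1 + 2 * p) * b ≤ c + 8 * h := by
    calc p * (1 + 2 * p) * b = (1 + 2 * p) * (p * b) := by ring
      _ ≤ (1 + t) * ((1 + 4 * t) * ((1 + t) * c)) := by gcongr
      _ = ((1 + t) * (1 + 4 * t) * (1 + t)) * c := by ring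
      _ ≤ (1 + 8 * t) * c := by gcongr; nlinarith [mul_nonneg ht0 ht0]
      _ ≤ _ := by linarith
  calc Real.exp (-c) * (1 - 8 * h) ≤ Real.exp (-c) * Real.exp (-(8 * h)) := by
        gcongr; linarith [Real.add_one_le_exp (-(8 * h))]
    _ = Real.exp (-(c + 8 * h)) := by rw [← Real.exp_add]; ring_nf
    _ ≤ _ := by gcongr

lemma mul_le_one_sub_one_sub_pow {p c s D : ℝ} {a : ℕ} (hp : 0 ≤ p) (hp1 : p ≤ 1) (hs : 0 ≤ s)
    (hs1 : s ≤ 1) (hD : c ≤ p * D) (ha : s * D ≤ a) :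
    s * (1 - Real.exp (-c)) ≤ 1 - (1 - p) ^ a := by
  have h₁ : (1 - p) ^ a ≤ Real.exp (-(s * c)) := by
    calc (1 - p) ^ a ≤ Real.exp (-p) ^ a :=
          pow_le_pow_left₀ (by linarith) (by linarith [Real.add_one_le_exp (-p)]) a
      _ = Real.exp (-(a * p)) := by rw [← Real.exp_nat_mul]; ring_nf
      _ ≤ _ := by
        refine Real.exp_le_exp.2 (neg_le_neg ?_)
        calc s * c ≤ s * (p * D) := by gcongr
          _ = s * D * p := by ring
          _ ≤ a * p := by gcongr
  have h₂ := exp_neg_mul_le (c := c) hs hs1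
  linarith

lemma mul_le_mul_one_sub_pow {p c t h D n : ℝ} {a b k : ℕ} (hp : 0 ≤ p) (hp1 : p ≤ 1)
    (hpt : 2 * p ≤ t) (ht : t ≤ 1 / 50) (hh0 : 0 ≤ h) (hh : h ≤ 1 / 50) (hc : 0 ≤ c)
    (htc : t * c ≤ h) (hcD : c ≤ p * D) (hDc : p * D ≤ (1 + t) * c) (hn : 0 ≤ n)
    (ha : (1 - 11 * h) * D ≤ a) (hb : b ≤ (1 + 4 * t) * D) (hk : (1 - h) * n ≤ k) :
    (1 - 20 * h) * (Real.exp (-c) * (1 - Real.exp (-c)) * n) ≤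
      k * ((1 - p) ^ b * (1 - (1 - p) ^ a)) := by
  have h₂ := exp_neg_mul_le_one_sub_pow hp hpt ht hc htc hDc hb
  have h₃ := mul_le_one_sub_one_sub_pow hp hp1 (by linarith) (by linarith) hcD ha
  have hec : 0 ≤ 1 - Real.exp (-c) := by
    linarith [Real.exp_le_one_iff.2 (neg_nonpos.2 hc)]
  have he := Real.exp_pos (-c)
  have h8 : 0 ≤ 1 - 8 * h := by linarith
  have h11 : 0 ≤ 1 - 11 * h := by linarith
  calc (1 - 20 * h) * (Real.exp (-c) * (1 - Real.exp (-c)) * n) ≤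
        (1 - h) * (1 - 8 * h) * (1 - 11 * h) * (Real.exp (-c) * (1 - Real.exp (-c)) * n) := by
        gcongr
        linarith [mul_nonneg (mul_nonneg hh0 hh0) (by linarith : 0 ≤ 107 - 88 * h)]
    _ = (1 - h) * n * (Real.exp (-c) * (1 - 8 * h) * ((1 - 11 * h) * (1 - Real.exp (-c)))) := by
        ring
    _ ≤ _ := mul_le_mul hk (mul_le_mul h₂ h₃ (mul_nonneg h11 hec) (pow_nonneg (by linarith) b))
        (mul_nonneg (mul_nonneg he.le h8) (mul_nonneg h11 hec)) (Nat.cast_nonneg k)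

/-- If `p * (n - 1) = d` and `c * n = d * D` with `c` at most logarithmic, then `p` is small and
`p * D` is close to `c`. -/
lemma mul_bounds_of_mul_eq {p d c h η L D n : ℝ} (hp : 0 ≤ p) (hd : d = p * (n - 1))
    (hcn : c * n = d * D) (hn : 2 ≤ n) (hdD : d ≤ D) (hd0 : 0 ≤ d) (hc0 : 0 ≤ c) (hcL : c ≤ L)
    (hL1 : 1 ≤ L) (hη0 : 0 ≤ η) (hηh : η ≤ h) (hh1 : h / L ≤ 1) (hη1 : η ≤ 1)
    (hLn : 16 * L ^ 3 ≤ η ^ 2 * n) :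
    2 * p ≤ h / L ∧ c ≤ p * D ∧ p * D ≤ (1 + h / L) * c := by
  have hL3 : L ≤ L ^ 3 := le_self_pow₀ hL1 (by norm_num)
  have hL0 : 0 < L := by linarith
  have hn1 : n / 2 ≤ n - 1 := by linarith
  have hpD : p * D * (n - 1) = c * n := by rw [hcn, hd]; ring
  have hn1' : (0 : ℝ) < n - 1 := by linarith
  have hcD : c ≤ p * D := by
    refine le_of_mul_le_mul_right ?_ hn1'
    rw [hpD]; gcongr; linarith
  have hLn' : 2 * L ≤ h * n := by
    calc 2 * L ≤ 16 * L ^ 3 := by linarith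
      _ ≤ η ^ 2 * n := hLn
      _ ≤ h * n := by gcongr; exact (pow_le_of_le_one hη0 hη1 two_ne_zero).trans hηh
  have htn : 2 ≤ h / L * n := by rw [div_mul_eq_mul_div, le_div_iff₀ hL0]; exact hLn'
  have hDc : p * D ≤ (1 + h / L) * c := by
    refine le_of_mul_le_mul_right ?_ hn1'
    rw [hpD]
    linarith [mul_nonneg hc0 (sub_nonneg.2 htn), mul_nonneg hc0 (by linarith : 0 ≤ 1 - h / L)]
  have hpt : 2 * p ≤ h / L := by
    rw [le_div_iff₀ hL0]
    have h₁ : d * d ≤ L * n := by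
      calc d * d ≤ d * D := by gcongr
        _ = c * n := hcn.symm
        _ ≤ L * n := by gcongr
    have h₂ : p * (n / 2) ≤ d := by rw [hd]; gcongr
    have h₃ : p * (n / 2) * (p * (n / 2)) ≤ L * n := le_trans (by gcongr) h₁
    have h₄ : p ^ 2 * n ≤ 4 * L := by
      refine le_of_mul_le_mul_right ?_ (by linarith : (0 : ℝ) < n)
      linarith
    have h₅ : (2 * p * L) ^ 2 * n ≤ η ^ 2 * n := by
      calc (2 * p * L) ^ 2 * n = 4 * L ^ 2 * (p ^ 2 * n) := by ring
        _ ≤ 4 * L ^ 2 * (4 * L) := by gcongr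
        _ = 16 * L ^ 3 := by ring
        _ ≤ _ := hLn
    have h₆ : (2 * p * L) ^ 2 ≤ η ^ 2 := le_of_mul_le_mul_right h₅ (by linarith)
    exact (le_of_sq_le_sq h₆ hη0).trans hηh
  exact ⟨hpt, hcD, hDc⟩

/-- The estimate of `le_gnpProb_distinguishing` with all auxiliary parameters chosen. -/
lemma le_gnpProb_distinguishing_log {n m : ℕ} {p d c h η L : ℝ} (hp : 0 ≤ p) (hp1 : p ≤ 1)
    (hd : d = p * (n - 1)) (hc : c = d ^ (m + 2) / n) (hL : L = Real.log n) (hn : 2 ≤ n)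
    (hh : 0 < h) (hh1 : h ≤ 1 / 50) (hη : (m + 1) * η = h) (hL1 : 1 ≤ L)
    (hdL : 100 * L ^ 3 ≤ η ^ 3 * d) (hdn : d ^ (m + 1) ≤ η / 8 * n)
    (hLn : 16 * L ^ 3 ≤ η ^ 2 * n) :
    1 - (2 * ((1 + Real.exp (-(2 * L))) ^ n - 1) + n ^ 2 * Real.exp (-(3 * L))) ≤
      gnpProb n p {G | ∀ x y : Fin n, x ≠ y →
        (2 - 50 * h) * (d ^ (m + 1) + Real.exp (-c) * (1 - Real.exp (-c)) * n) ≤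
          ({z : Fin n | G.dist z x ≠ G.dist z y}.ncard : ℝ)} := by
  have hn' : (2 : ℝ) ≤ n := by exact_mod_cast hn
  have hη0 : 0 < η := by
    by_contra! hcon
    have : (m + 1 : ℝ) * η ≤ 0 := mul_nonpos_of_nonneg_of_nonpos (by positivity) hcon
    linarith
  have hηh : η ≤ h := by
    rw [← hη]; linarith [mul_nonneg (Nat.cast_nonneg (α := ℝ) m) hη0.le]
  have hL3 : L ≤ L ^ 3 := le_self_pow₀ hL1 (by norm_num)
  have hL0 : 0 < L := by linarith
  have hη50 : η ≤ 1 / 50 := hηh.trans hh1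
  have hd0 : 0 < d := by
    by_contra! hcon
    have := mul_nonpos_of_nonneg_of_nonpos (pow_nonneg hη0.le 3) hcon
    linarith
  have hd100 : 100 * L ≤ η ^ 3 * d := by linarith
  have hηd2 : 100 * L ≤ η ^ 2 * d := by
    refine hd100.trans ?_
    gcongr 1
    exact pow_le_pow_of_le_one hη0.le (by linarith) (by norm_num)
  have hηd1 : 100 * L ≤ η * d := by
    refine hd100.trans ?_
    gcongr 1
    exact pow_le_of_le_one hη0.le (by linarith) (by norm_num)
  have hd1 : 1 ≤ d := by linarith [mul_le_mul_of_nonneg_right hη50 hd0.le]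
  set D := d ^ (m + 1) with hD
  have hdD : d ≤ D := le_self_pow₀ hd1 (by omega)
  have hpn : p * n = d + p := by rw [hd]; ring
  have hD0 : 0 < D := by linarith
  set ε := η / L with hε
  have hε0 : 0 < ε := by positivity
  have hεη : ε ≤ η := div_le_self hη0.le hL1
  set t := h / L with ht
  have ht0 : 0 < t := by positivity
  have hth : t ≤ h := div_le_self hh.le hL1
  have hmε : (m + 1 : ℝ) * ε = t := by rw [hε, ht, ← hη]; ring
  have hεd : 3 ≤ ε * d := by
    rw [hε, div_mul_eq_mul_div, le_div_iff₀ hL0]; linarith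
  set u := (1 + 2 * ε) * d with hu
  set l := (1 - η) ^ 3 * d with hl
  have huD : u ^ (m + 1) ≤ (1 + 4 * t) * D := by
    rw [hu, mul_pow, ← hD]
    gcongr
    have := one_add_pow_le_one_add_two_mul (x := 2 * ε) (by positivity) (k := m + 1)
      (by push_cast; linarith)
    push_cast at this
    linarith
  have hlD : (1 - 3 * h) * D ≤ l ^ (m + 1) := by
    rw [hl, mul_pow, ← hD, ← pow_mul]
    gcongr
    have := one_add_mul_le_pow (a := -η) (by linarith) (3 * (m + 1))
    push_cast at this
    rw [← sub_eq_add_neg 1 η] at this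
    linarith
  have hu0 : 0 ≤ u := by positivity
  have hdu : d ≤ u := by rw [hu]; linarith [mul_nonneg hε0.le hd0.le]
  have hum : u ^ m * d ≤ 2 * D := by
    calc u ^ m * d ≤ u ^ m * u := by gcongr
      _ = u ^ (m + 1) := by ring
      _ ≤ (1 + 4 * t) * D := huD
      _ ≤ 2 * D := by gcongr; linarith
  have hum' : 2 * u ^ m ≤ η * D := by
    have h₁ : u ^ m * 100 ≤ u ^ m * (η * d) := by gcongr; linarith
    have h₂ : η * (u ^ m * d) ≤ η * (2 * D) := by gcongr
    linarith [pow_nonneg hu0 m, mul_nonneg hη0.le hD0.le]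
  have hηD : 100 ≤ η * D := by linarith [mul_le_mul_of_nonneg_left hdD hη0.le]
  have hDη : η * D ≤ D := mul_le_of_le_one_left hD0.le (by linarith)
  have hKn : 2 * u ^ m ≤ η * n := by
    linarith [mul_nonneg hη0.le (Nat.cast_nonneg (α := ℝ) n)]
  have hn1 : (n : ℝ) / 2 ≤ n - 1 := by linarith
  have hK : 2 * u ^ m * p ≤ η := by
    have h₁ : u ^ m * p * (n / 2) ≤ 2 * D := by
      calc u ^ m * p * (n / 2) ≤ u ^ m * p * (n - 1) := by gcongr
        _ = u ^ m * d := by rw [hd]; ring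
        _ ≤ _ := hum
    refine le_of_mul_le_mul_right ?_ (by linarith : (0 : ℝ) < n)
    linarith
  have hexp : Real.exp (-(ε ^ 2 * (p * n) / 4)) ≤ Real.exp (-(2 * L)) := by
    gcongr
    have h₁ : ε ^ 2 * L ^ 2 = η ^ 2 := by rw [hε]; field_simp
    have h₂ : 100 * L ^ 3 ≤ ε ^ 2 * d * L ^ 2 := by
      calc 100 * L ^ 3 ≤ η ^ 3 * d := hdL
        _ ≤ η ^ 2 * d := by
          gcongr 1
          exact pow_le_pow_of_le_one hη0.le (by linarith) (by norm_num)
        _ = _ := by rw [← h₁]; ring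
    have h₃ : 100 * L ≤ ε ^ 2 * d := by
      refine le_of_mul_le_mul_right ?_ (by positivity : 0 < L ^ 2)
      linarith
    rw [hpn]
    linarith [mul_nonneg (sq_nonneg ε) hp]
  have hexp' : Real.exp (-(η ^ 2 * ((1 - η) ^ 2 * (p * n)) / 4)) ≤ Real.exp (-(2 * L)) := by
    gcongr
    have h₁ : (1 / 4 : ℝ) ≤ (1 - η) ^ 2 := by linarith [sq_nonneg η]
    have h₂ : η ^ 2 * (1 / 4 * d) ≤ η ^ 2 * ((1 - η) ^ 2 * (p * n)) := by
      gcongr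
      linarith
    linarith
  have hu1 : 1 + (1 + ε) * (p * n) ≤ u := by
    rw [hu, hpn]; linarith [mul_le_mul_of_nonneg_left hp1 hε0.le]
  have hl1 : l ≤ (1 - η) ^ 3 * (p * n) := by
    have : 0 ≤ 1 - η := by linarith
    rw [hl, hpn]
    gcongr
    linarith
  have hl0 : 0 ≤ l := mul_nonneg (pow_nonneg (by linarith) 3) hd0.le
  have hlu : (1 - 10 * h) * D ≤ 2 * l ^ (m + 1) - u ^ (m + 1) := by
    have : t * D ≤ h * D := by gcongr
    linarith
  have hc0 : 0 ≤ c := by rw [hc]; positivity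
  have hec : 0 ≤ 1 - Real.exp (-c) := by
    have := Real.exp_le_one_iff.2 (neg_nonpos.2 hc0)
    linarith
  set Y := Real.exp (-c) * (1 - Real.exp (-c)) * n with hY
  have hY0 : 0 ≤ Y := by positivity
  have hhD : η * D ≤ h * D := by gcongr
  by_cases hYD : Y ≤ η * D
  · refine le_gnpProb_distinguishing (u := u) (l := l) (K := 2 * u ^ m) (M := 0) (ε := ε)
      (η := η) hp hp1 hε0.le (by linarith) hη0.le (by linarith) hexp hexp' hu1 hl0 hl1 hK hKn
      le_rfl le_rfl (Real.exp_pos _).le (fun h => (h rfl).elim) ?_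
    have : (2 - 50 * h) * (D + Y) ≤ (2 - 50 * h) * (D + h * D) := by
      gcongr
      · linarith
      · linarith
    linarith [mul_nonneg hh.le hD0.le, mul_nonneg hh.le (mul_nonneg hh.le hD0.le)]
  push Not at hYD
  have hcL : c ≤ L := by
    have h₁ : 1 ≤ Real.exp (-c) * n := by
      have : Y ≤ Real.exp (-c) * n := by
        rw [hY]
        gcongr
        refine mul_le_of_le_one_right (Real.exp_pos _).le ?_
        linarith [Real.exp_pos (-c)]
      linarith
    rw [hL, Real.le_log_iff_exp_le (by linarith)]
    rw [Real.exp_neg, inv_mul_eq_div, one_le_div (Real.exp_pos _)] at h₁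
    exact h₁
  have hcn : c * n = d * D := by rw [hc, hD]; field_simp; ring
  obtain ⟨hpt, hcD, hDc⟩ := mul_bounds_of_mul_eq hp hd hcn hn' hdD hd0.le hc0 hcL hL1 hη0.le hηh
    (hth.trans (by linarith)) (by linarith) hLn
  have htc : t * c ≤ h := by
    calc t * c ≤ t * L := by gcongr
      _ = h := by rw [ht]; field_simp
  refine le_gnpProb_distinguishing (u := u) (l := l) (K := 2 * u ^ m) (M := (1 - 20 * h) * Y)
    (ε := ε) (η := η) hp hp1 hε0.le (by linarith) hη0.le (by linarith) hexp hexp' hu1 hl0 hl1 hK hKn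
    le_rfl (mul_nonneg (by linarith) hY0) (Real.exp_pos _).le (fun _ => ⟨?_, ?_⟩) ?_
  · gcongr
    have h₁ : 1 / 2 * Y ≤ (1 - 20 * h) * Y := mul_le_mul_of_nonneg_right (by linarith) hY0
    have h₂ : η ^ 2 * (1 / 2 * (η * D)) ≤ η ^ 2 * ((1 - 20 * h) * Y) :=
      mul_le_mul_of_nonneg_left (by linarith) (sq_nonneg η)
    have h₃ : η ^ 3 * d ≤ η ^ 3 * D := by gcongr
    linarith
  · intro a b k ha hb hk
    have h₁ : (1 - 11 * h) * D ≤ a := by linarith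
    have htD : t * D ≤ 1 / 50 * D := by gcongr; linarith
    have h₄ : (1 - h) * n ≤ k := by linarith [mul_le_mul_of_nonneg_right hηh (Nat.cast_nonneg (α := ℝ) n)]
    exact mul_le_mul_one_sub_pow hp hp1 hpt (hth.trans hh1) hh.le hh1 hc0 htc hcD hDc
      (Nat.cast_nonneg n) h₁ (hb.trans huD) h₄
  · have h₁ : (1 - h) * ((1 - 20 * h) * Y) ≤ (1 - η) * ((1 - 20 * h) * Y) := by
      gcongr
      exact mul_nonneg (by linarith) hY0
    have h₂ : (1 - 21 * h) * Y ≤ (1 - h) * ((1 - 20 * h) * Y) := by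
      linarith [mul_nonneg (mul_nonneg hh.le hh.le) hY0]
    linarith [mul_nonneg hh.le hD0.le, mul_nonneg hh.le hY0]

end Numerics
lemma one_add_exp_pow_add_le {n : ℕ} (hn : 1 ≤ n) :
    2 * ((1 + Real.exp (-(2 * Real.log n))) ^ n - 1) + n ^ 2 * Real.exp (-(3 * Real.log n)) ≤
      2 * (Real.exp (1 / n) - 1) + 1 / n := by
  have hn' : (0 : ℝ) < n := by exact_mod_cast hn
  have hexp : ∀ k : ℕ, Real.exp (-(k * Real.log n)) = ((n : ℝ) ^ k)⁻¹ := fun k => by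
    rw [Real.exp_neg, Real.exp_nat_mul, Real.exp_log hn']
  have h₂ := hexp 2
  have h₃ := hexp 3
  push_cast at h₂ h₃
  rw [h₂, h₃]
  have h₄ : (1 + ((n : ℝ) ^ 2)⁻¹) ^ n ≤ Real.exp (1 / n) := by
    calc (1 + ((n : ℝ) ^ 2)⁻¹) ^ n ≤ Real.exp (((n : ℝ) ^ 2)⁻¹) ^ n :=
          pow_le_pow_left₀ (by positivity) (by linarith [Real.add_one_le_exp (((n : ℝ) ^ 2)⁻¹)]) n
      _ = Real.exp (1 / n) := by rw [← Real.exp_nat_mul]; congr 1; field_simp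
  have h₅ : (n : ℝ) ^ 2 * ((n : ℝ) ^ 3)⁻¹ = 1 / n := by field_simp
  linarith

lemma tendsto_one_sub_exp_one_div :
    Tendsto (fun n : ℕ => 1 - (2 * (Real.exp (1 / n) - 1) + 1 / (n : ℝ))) atTop (𝓝 1) := by
  have h₁ := tendsto_one_div_atTop_nhds_zero_nat (𝕜 := ℝ)
  have h₂ := (Real.continuous_exp.tendsto 0).comp h₁
  have := ((((h₂.sub_const 1).const_mul 2).add h₁).const_sub 1)
  simpa using this

lemma eventually_mul_log_pow_three_le {a : ℝ} (ha : 0 < a) :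
    ∀ᶠ n : ℕ in atTop, 16 * Real.log n ^ 3 ≤ a * n := by
  have h := ((isLittleO_pow_log_id_atTop (n := 3)).comp_tendsto
    (tendsto_natCast_atTop_atTop (R := ℝ))).def (by positivity : 0 < a / 16)
  filter_upwards [h] with n hn
  simp only [Function.comp_apply, id, Real.norm_eq_abs, Nat.abs_cast] at hn
  linarith [le_abs_self (Real.log n ^ 3)]

/-- Section 3, sparse case: if `p = o(1)` and `d ≫ log³ n`, then a.a.s. every pair
of distinct vertices `x, y` is distinguished by at least
`(2+o(1))·(d^i + e^{-c}(1−e^{-c})n)` vertices. -/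
theorem stmt_15 (p d c : ℕ → ℝ)
    (hp : ∀ n, 0 ≤ p n ∧ p n ≤ 1)
    (hpo : Tendsto p atTop (𝓝 0))
    (hd : ∀ n, d n = p n * ((n : ℝ) - 1))
    (hd_lower : Tendsto (fun n : ℕ => d n / (Real.log n) ^ 3) atTop atTop)
    (i : ℕ) (hi1 : 1 ≤ i)
    (hi : (fun n : ℕ => d n ^ i) =o[atTop] (fun n : ℕ => (n : ℝ)))
    (hi_max : ∀ j : ℕ, ((fun n : ℕ => d n ^ j) =o[atTop] (fun n : ℕ => (n : ℝ))) → j ≤ i)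
    (hc : ∀ n : ℕ, c n = d n ^ (i + 1) / n) :
    ∀ δ : ℝ, 0 < δ →
      Tendsto (fun n : ℕ => gnpProb n (p n)
        {G : SimpleGraph (Fin n) | ∀ x y : Fin n, x ≠ y →
          (2 - δ) * (d n ^ i + Real.exp (-c n) * (1 - Real.exp (-c n)) * n) ≤
            ({z : Fin n | G.dist z x ≠ G.dist z y}.ncard : ℝ)})
        atTop (𝓝 1) := by
  intro δ hδ
  obtain ⟨m, rfl⟩ : ∃ m, i = m + 1 := ⟨i - 1, by omega⟩
  set h : ℝ := min δ 1 / 50 with hh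
  have hh0 : 0 < h := by positivity
  have hh1 : h ≤ 1 / 50 := by rw [hh]; gcongr; exact min_le_right _ _
  have hhδ : 50 * h ≤ δ := by rw [hh]; linarith [min_le_left δ 1]
  set η : ℝ := h / (m + 1) with hη
  have hη0 : 0 < η := by positivity
  have hηm : (m + 1 : ℝ) * η = h := by rw [hη]; field_simp
  refine tendsto_of_tendsto_of_tendsto_of_le_of_le' tendsto_one_sub_exp_one_div
    tendsto_const_nhds ?_ (Eventually.of_forall fun n => ?_)
  · filter_upwards [eventually_ge_atTop 2,
      (Real.tendsto_log_atTop.comp (tendsto_natCast_atTop_atTop (R := ℝ))).eventually_ge_atTop 1,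
      hd_lower.eventually_ge_atTop (100 / η ^ 3), hi.def (by positivity : 0 < η / 8),
      eventually_mul_log_pow_three_le (by positivity : 0 < η ^ 2)] with n hn hL hdL hdn hLn
    simp only [Function.comp_apply] at hL
    rw [div_le_div_iff₀ (by positivity) (by positivity)] at hdL
    rw [Real.norm_eq_abs, Real.norm_natCast] at hdn
    have hd0 : 0 ≤ d n := by
      have : (2 : ℝ) ≤ n := by exact_mod_cast hn
      rw [hd]
      exact mul_nonneg (hp n).1 (by linarith)
    have hc0 : 0 ≤ c n := by rw [hc]; positivity
    have hec : 0 ≤ 1 - Real.exp (-c n) := by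
      linarith [Real.exp_le_one_iff.2 (neg_nonpos.2 hc0)]
    have key := le_gnpProb_distinguishing_log (hp n).1 (hp n).2 (hd n) (hc n) rfl hn hh0 hh1 hηm hL
      (by linarith) ((le_abs_self _).trans hdn) hLn
    refine le_trans (by linarith [one_add_exp_pow_add_le (n := n) (by omega)]) (key.trans ?_)
    rw [gnpProb_eq_coinProb, gnpProb_eq_coinProb]
    refine coinProb_mono (hp n).1 (hp n).2 fun ω hω x y hxy => le_trans ?_ (hω x y hxy)
    gcongr
  · rw [gnpProb_eq_coinProb]
    exact coinProb_le_one (hp n).1 (hp n).2 _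
end

section
/- Fix a real number x with 0 < x < 1 such that 1/x is not an integer, and let i = ⌊1/x⌋. Then for G ∈ G(n, n^{x−1}), asymptotically almost surely β(G) = n^{1 − i x + o(1)}; equivalently, log β(G) / log n converges in probability to 1 − x⌊1/x⌋. -/
open Filter Real Asymptotics
open scoped Topology

section Probability

open Finset
open scoped Classical

lemma gnpProb_eq_sum_powerset (n : ℕ) (p : ℝ) (Q : Set (Sym2 (Fin n)) → Prop) :
    gnpProb n p {G | Q G.edgeSet} =
      ∑ s ∈ (⊤ : SimpleGraph (Fin n)).edgeFinset.powerset.filter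
          (fun s : Finset (Sym2 (Fin n)) => Q s),
        p ^ #s * (1 - p) ^ (#(⊤ : SimpleGraph (Fin n)).edgeFinset - #s) := by
  rw [gnpProb, tsum_fintype]
  simp only [Set.indicator_apply, Set.mem_ofPred_eq]
  rw [← Finset.sum_filter]
  refine Finset.sum_bij (fun G _ => G.edgeFinset) ?_ ?_ ?_ ?_
  · intro G hG
    simp only [mem_filter, mem_univ, true_and] at hG
    simp only [mem_filter, mem_powerset, SimpleGraph.coe_edgeFinset, hG, and_true]
    exact SimpleGraph.edgeFinset_mono le_top
  · intro G _ H _ h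
    exact SimpleGraph.edgeFinset_inj.1 h
  · intro s hs
    simp only [mem_filter, mem_powerset] at hs
    have h : (SimpleGraph.fromEdgeSet (s : Set (Sym2 (Fin n)))).edgeSet = s := by
      rw [SimpleGraph.edgeSet_fromEdgeSet, sdiff_eq_left, Set.disjoint_left]
      intro e he
      have := hs.1 he
      simpa using this
    refine ⟨SimpleGraph.fromEdgeSet s, ?_, ?_⟩
    · simp only [mem_filter, mem_univ, true_and, h, hs.2]
    · rw [← Finset.coe_inj, SimpleGraph.coe_edgeFinset, h]
  · intro G _
    rw [gnpWeight, Nat.card_eq_fintype_card, ← SimpleGraph.edgeFinset_card,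
      SimpleGraph.card_edgeFinset_top_eq_card_choose_two, Fintype.card_fin]

lemma gnpProb_subset_edgeSet {n : ℕ} (p : ℝ) {S : Finset (Sym2 (Fin n))}
    (hS : S ⊆ (⊤ : SimpleGraph (Fin n)).edgeFinset) :
    gnpProb n p {G | (S : Set (Sym2 (Fin n))) ⊆ G.edgeSet} = p ^ #S := by
  rw [gnpProb_eq_sum_powerset n p (fun E => (S : Set (Sym2 (Fin n))) ⊆ E)]
  set E := (⊤ : SimpleGraph (Fin n)).edgeFinset
  have h := Finset.sum_pow_mul_eq_add_pow p (1 - p) (E \ S)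
  rw [add_sub_cancel, one_pow] at h
  refine Eq.trans ?_ ((congrArg (p ^ #S * ·) h).trans (mul_one _))
  simp only [Finset.mul_sum]
  refine Finset.sum_bij' (fun s _ => s \ S) (fun s _ => s ∪ S) ?_ ?_ ?_ ?_ ?_
  · intro s hs
    simp only [mem_filter, mem_powerset] at hs ⊢
    exact sdiff_subset_sdiff hs.1 le_rfl
  · intro s hs
    simp only [mem_filter, mem_powerset] at hs ⊢
    exact ⟨union_subset (hs.trans sdiff_subset) hS, by simp⟩
  · intro s hs
    simp only [mem_filter, coe_subset] at hs
    exact sdiff_union_of_subset hs.2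
  · intro s hs
    rw [mem_powerset] at hs
    rw [union_sdiff_right, sdiff_eq_left]
    exact disjoint_of_subset_left hs sdiff_disjoint
  · intro s hs
    simp only [mem_filter, mem_powerset, coe_subset] at hs
    have h1 := card_sdiff_add_card_eq_card hs.2
    have h2 := card_sdiff_add_card_eq_card hS
    have h3 := card_le_card hs.1
    have h4 : #s = #S + #(s \ S) := by omega
    have h5 : #E - #s = #(E \ S) - #(s \ S) := by omega
    rw [← mul_assoc, ← pow_add, ← h4, h5]

lemma gnpProb_disjoint_edgeSet {n : ℕ} (p : ℝ) {S : Finset (Sym2 (Fin n))}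
    (hS : S ⊆ (⊤ : SimpleGraph (Fin n)).edgeFinset) :
    gnpProb n p {G | Disjoint (S : Set (Sym2 (Fin n))) G.edgeSet} = (1 - p) ^ #S := by
  rw [gnpProb_eq_sum_powerset n p (fun E => Disjoint (S : Set (Sym2 (Fin n))) E)]
  set E := (⊤ : SimpleGraph (Fin n)).edgeFinset
  have h := Finset.sum_pow_mul_eq_add_pow p (1 - p) (E \ S)
  rw [add_sub_cancel, one_pow] at h
  refine Eq.trans ?_ ((congrArg ((1 - p) ^ #S * ·) h).trans (mul_one _))
  simp only [Finset.mul_sum]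
  refine Finset.sum_congr ?_ ?_
  · ext s
    simp only [mem_filter, mem_powerset, disjoint_coe, subset_sdiff, disjoint_comm]
  · intro s hs
    rw [mem_powerset] at hs
    have h2 := card_sdiff_add_card_eq_card hS
    have h3 := card_le_card hs
    have h4 : #E - #s = #S + (#(E \ S) - #s) := by omega
    rw [mul_left_comm, ← pow_add, h4]

lemma gnpWeight_nonneg {n : ℕ} {p : ℝ} (hp0 : 0 ≤ p) (hp1 : p ≤ 1) (G : SimpleGraph (Fin n)) :
    0 ≤ gnpWeight n p G :=
  mul_nonneg (pow_nonneg hp0 _) (pow_nonneg (sub_nonneg.2 hp1) _)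

lemma gnpProb_mono {n : ℕ} {p : ℝ} (hp0 : 0 ≤ p) (hp1 : p ≤ 1)
    {A B : Set (SimpleGraph (Fin n))} (h : A ⊆ B) : gnpProb n p A ≤ gnpProb n p B := by
  rw [gnpProb, gnpProb, tsum_fintype, tsum_fintype]
  exact Finset.sum_le_sum fun G _ =>
    Set.indicator_le_indicator_of_subset h (gnpWeight_nonneg hp0 hp1) G

lemma gnpProb_univ (n : ℕ) (p : ℝ) : gnpProb n p Set.univ = 1 := by
  simpa using gnpProb_subset_edgeSet (n := n) p (S := ∅) (by simp)

lemma gnpProb_add_compl (n : ℕ) (p : ℝ) (A : Set (SimpleGraph (Fin n))) :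
    gnpProb n p A + gnpProb n p Aᶜ = 1 := by
  rw [← gnpProb_univ n p, gnpProb, gnpProb, gnpProb, tsum_fintype, tsum_fintype, tsum_fintype,
    ← Finset.sum_add_distrib]
  refine Finset.sum_congr rfl fun G _ => ?_
  rw [Set.indicator_univ, Set.indicator_self_add_compl_apply]

lemma gnpProb_exists_mem_le {n : ℕ} {p : ℝ} (hp0 : 0 ≤ p) (hp1 : p ≤ 1) {ι : Type*}
    (s : Finset ι) (Q : ι → SimpleGraph (Fin n) → Prop) :
    gnpProb n p {G | ∃ k ∈ s, Q k G} ≤ ∑ k ∈ s, gnpProb n p {G | Q k G} := by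
  simp only [gnpProb, tsum_fintype]
  rw [Finset.sum_comm]
  refine Finset.sum_le_sum fun G _ => ?_
  have hnn : ∀ k ∈ s, 0 ≤ Set.indicator {G | Q k G} (gnpWeight n p) G :=
    fun k _ => Set.indicator_nonneg (fun G _ => gnpWeight_nonneg hp0 hp1 G) G
  by_cases h : ∃ k ∈ s, Q k G
  · obtain ⟨k, hk, hQ⟩ := h
    refine le_trans ?_ (Finset.single_le_sum hnn hk)
    rw [Set.indicator_of_mem (show G ∈ {G | Q k G} from hQ),
      Set.indicator_of_mem (show G ∈ {G | ∃ k ∈ s, Q k G} from ⟨k, hk, hQ⟩)]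
  · rw [Set.indicator_of_notMem (show G ∉ {G | ∃ k ∈ s, Q k G} from h)]
    exact Finset.sum_nonneg hnn

lemma gnpProb_exists_mem_le_card_mul {n : ℕ} {p : ℝ} (hp0 : 0 ≤ p) (hp1 : p ≤ 1) {ι : Type*}
    (s : Finset ι) (Q : ι → SimpleGraph (Fin n) → Prop) {q : ℝ}
    (h : ∀ k ∈ s, gnpProb n p {G | Q k G} ≤ q) :
    gnpProb n p {G | ∃ k ∈ s, Q k G} ≤ #s * q := by
  refine (gnpProb_exists_mem_le hp0 hp1 s Q).trans ?_
  rw [← nsmul_eq_mul]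
  exact Finset.sum_le_card_nsmul _ _ _ h

lemma gnpProb_or_le {n : ℕ} {p : ℝ} (hp0 : 0 ≤ p) (hp1 : p ≤ 1)
    (Q R : SimpleGraph (Fin n) → Prop) :
    gnpProb n p {G | Q G ∨ R G} ≤ gnpProb n p {G | Q G} + gnpProb n p {G | R G} := by
  have h := gnpProb_exists_mem_le hp0 hp1 (univ : Finset Bool) (fun b => bif b then Q else R)
  simpa only [Fintype.univ_bool, mem_insert, mem_singleton, exists_eq_or_imp, exists_eq_left,
    sum_insert, Bool.true_eq_false, not_false_eq_true, sum_singleton, cond_true, cond_false] using h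

lemma card_image_sym2Mk {n : ℕ} {X Y : Finset (Fin n)} (hXY : Disjoint X Y)
    {P : Finset (Fin n × Fin n)} (hP : P ⊆ X ×ˢ Y) : #(P.image fun e => s(e.1, e.2)) = #P := by
  refine Finset.card_image_of_injOn ?_
  rintro ⟨a, b⟩ hab ⟨c, d⟩ hcd h
  have h1 := mem_product.1 (hP hab)
  have h2 := mem_product.1 (hP hcd)
  rw [Finset.disjoint_left] at hXY
  simp only [Sym2.eq_iff] at h
  rcases h with ⟨rfl, rfl⟩ | ⟨rfl, rfl⟩
  · rfl
  · exact absurd h2.2 (hXY h1.1)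

lemma image_sym2Mk_subset {n : ℕ} {X Y : Finset (Fin n)} (hXY : Disjoint X Y)
    {P : Finset (Fin n × Fin n)} (hP : P ⊆ X ×ˢ Y) :
    (P.image fun e => s(e.1, e.2)) ⊆ (⊤ : SimpleGraph (Fin n)).edgeFinset := by
  intro e he
  obtain ⟨⟨a, b⟩, hab, rfl⟩ := mem_image.1 he
  have h1 := mem_product.1 (hP hab)
  rw [Finset.disjoint_left] at hXY
  simp only [SimpleGraph.mem_edgeFinset, SimpleGraph.mem_edgeSet, SimpleGraph.top_adj]
  rintro rfl
  exact hXY h1.1 h1.2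

lemma gnpProb_forall_adj {n : ℕ} (p : ℝ) {X Y : Finset (Fin n)} (hXY : Disjoint X Y)
    {P : Finset (Fin n × Fin n)} (hP : P ⊆ X ×ˢ Y) :
    gnpProb n p {G | ∀ e ∈ P, G.Adj e.1 e.2} = p ^ #P := by
  rw [← card_image_sym2Mk hXY hP, ← gnpProb_subset_edgeSet p (image_sym2Mk_subset hXY hP)]
  congr 1
  ext G
  simp only [Set.mem_ofPred_eq, Set.subset_def, Finset.mem_coe, Finset.forall_mem_image,
    SimpleGraph.mem_edgeSet]

lemma gnpProb_forall_not_adj {n : ℕ} (p : ℝ) {X Y : Finset (Fin n)} (hXY : Disjoint X Y)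
    {P : Finset (Fin n × Fin n)} (hP : P ⊆ X ×ˢ Y) :
    gnpProb n p {G | ∀ e ∈ P, ¬ G.Adj e.1 e.2} = (1 - p) ^ #P := by
  rw [← card_image_sym2Mk hXY hP, ← gnpProb_disjoint_edgeSet p (image_sym2Mk_subset hXY hP)]
  congr 1
  ext G
  simp only [Set.mem_ofPred_eq, Set.disjoint_left, Finset.mem_coe, Finset.forall_mem_image,
    SimpleGraph.mem_edgeSet]

end Probability

section BadEvents

open Finset
open scoped Classical

/-- Some disjoint sets of sizes `a` and `c` have no edge between them. -/
def HasEmptyPair {V : Type*} (G : SimpleGraph V) (a c : ℕ) : Prop :=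
  ∃ A C : Finset V, Disjoint A C ∧ #A = a ∧ #C = c ∧ ∀ u ∈ A, ∀ v ∈ C, ¬ G.Adj u v

/-- Some vertex has at least `k` neighbours. -/
def HasStar {V : Type*} (G : SimpleGraph V) (k : ℕ) : Prop :=
  ∃ (v : V) (T : Finset V), v ∉ T ∧ #T = k ∧ ∀ u ∈ T, G.Adj v u

/-- Some disjoint sets of sizes `a` and `b` have at least `t` common outside neighbours. -/
def HasCommonNeighbors {V : Type*} (G : SimpleGraph V) (a b t : ℕ) : Prop :=
  ∃ A B T : Finset V, Disjoint A B ∧ Disjoint T A ∧ Disjoint T B ∧ #A = a ∧ #B = b ∧ #T = t ∧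
    ∀ u ∈ T, (∃ y ∈ A, G.Adj u y) ∧ ∃ y ∈ B, G.Adj u y

lemma gnpProb_empty (n : ℕ) (p : ℝ) : gnpProb n p ∅ = 0 := by
  simp [gnpProb]

lemma gnpProb_hasEmptyPair_le {n : ℕ} {p : ℝ} (hp0 : 0 ≤ p) (hp1 : p ≤ 1) (a c : ℕ) :
    gnpProb n p {G | HasEmptyPair G a c} ≤
      n.choose a * n.choose c * (1 - p) ^ (a * c) := by
  have hsub : {G : SimpleGraph (Fin n) | HasEmptyPair G a c} ⊆
      {G | ∃ k ∈ powersetCard a (univ : Finset (Fin n)) ×ˢ powersetCard c univ,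
        Disjoint k.1 k.2 ∧ ∀ e ∈ k.1 ×ˢ k.2, ¬ G.Adj e.1 e.2} := by
    rintro G ⟨A, C, hAC, hA, hC, h⟩
    refine ⟨(A, C), by simp [hA, hC], hAC, ?_⟩
    rintro ⟨u, v⟩ huv
    exact h u (mem_product.1 huv).1 v (mem_product.1 huv).2
  refine (gnpProb_mono hp0 hp1 hsub).trans ((gnpProb_exists_mem_le_card_mul hp0 hp1 _ _
    (q := (1 - p) ^ (a * c)) ?_).trans_eq (by simp))
  rintro ⟨A, C⟩ hk
  simp only [mem_product, mem_powersetCard_univ] at hk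
  by_cases hd : Disjoint A C
  · simp only [hd, true_and]
    rw [gnpProb_forall_not_adj p hd le_rfl, card_product, hk.1, hk.2]
  · simp only [hd, false_and]
    exact (gnpProb_empty n p).trans_le (pow_nonneg (sub_nonneg.2 hp1) _)

lemma gnpProb_hasStar_le {n : ℕ} {p : ℝ} (hp0 : 0 ≤ p) (hp1 : p ≤ 1) (k : ℕ) :
    gnpProb n p {G | HasStar G k} ≤ n * n.choose k * p ^ k := by
  have hsub : {G : SimpleGraph (Fin n) | HasStar G k} ⊆
      {G | ∃ e ∈ (univ : Finset (Fin n)) ×ˢ powersetCard k univ,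
        e.1 ∉ e.2 ∧ ∀ f ∈ {e.1} ×ˢ e.2, G.Adj f.1 f.2} := by
    rintro G ⟨v, T, hv, hT, h⟩
    refine ⟨(v, T), by simp [hT], hv, ?_⟩
    rintro ⟨u, w⟩ huw
    simp only [mem_product, mem_singleton] at huw
    rw [huw.1]
    exact h w huw.2
  refine (gnpProb_mono hp0 hp1 hsub).trans ((gnpProb_exists_mem_le_card_mul hp0 hp1 _ _
    (q := p ^ k) ?_).trans_eq (by simp))
  rintro ⟨v, T⟩ hk
  simp only [mem_product, mem_powersetCard_univ] at hk
  by_cases hd : v ∈ T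
  · simp only [hd, not_true, false_and]
    exact (gnpProb_empty n p).trans_le (pow_nonneg hp0 _)
  · simp only [hd, not_false_eq_true, true_and]
    rw [gnpProb_forall_adj p (disjoint_singleton_left.2 hd) le_rfl, card_product, hk.2,
      card_singleton, one_mul]

lemma gnpProb_forall_exists_adj_le {n : ℕ} {p : ℝ} (hp0 : 0 ≤ p) (hp1 : p ≤ 1)
    {A B T : Finset (Fin n)} (hAB : Disjoint A B) (hT : Disjoint T (A ∪ B)) :
    gnpProb n p {G | ∀ u ∈ T, (∃ y ∈ A, G.Adj u y) ∧ ∃ y ∈ B, G.Adj u y} ≤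
      (#A * #B) ^ #T * p ^ (2 * #T) := by
  set P : (T → Fin n × Fin n) → Finset (Fin n × Fin n) := fun φ =>
    univ.image (fun u : T => ((u : Fin n), (φ u).1)) ∪
      univ.image (fun u : T => ((u : Fin n), (φ u).2))
  have hsub : {G : SimpleGraph (Fin n) |
      ∀ u ∈ T, (∃ y ∈ A, G.Adj u y) ∧ ∃ y ∈ B, G.Adj u y} ⊆
      {G | ∃ φ ∈ Fintype.piFinset (fun _ : T => A ×ˢ B), ∀ e ∈ P φ, G.Adj e.1 e.2} := by
    intro G hG
    choose f hf hf' using fun u : T => (hG u u.2).1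
    choose g hg hg' using fun u : T => (hG u u.2).2
    refine ⟨fun u => (f u, g u), by simp [hf, hg], ?_⟩
    intro e he
    simp only [P, mem_union, mem_image, mem_univ, true_and] at he
    rcases he with ⟨u, rfl⟩ | ⟨u, rfl⟩
    · exact hf' u
    · exact hg' u
  refine (gnpProb_mono hp0 hp1 hsub).trans ((gnpProb_exists_mem_le_card_mul hp0 hp1 _ _
    (q := p ^ (2 * #T)) ?_).trans_eq (by simp))
  intro φ hφ
  simp only [Fintype.mem_piFinset, mem_product] at hφ
  have hP : P φ ⊆ T ×ˢ (A ∪ B) := by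
    intro e he
    simp only [P, mem_union, mem_image, mem_univ, true_and] at he
    rcases he with ⟨u, rfl⟩ | ⟨u, rfl⟩
    · simp [(hφ u).1]
    · simp [(hφ u).2]
  rw [gnpProb_forall_adj p hT hP]
  have hcard : #(P φ) = 2 * #T := by
    rw [card_union_of_disjoint, card_image_of_injective, card_image_of_injective, card_univ,
      Fintype.card_coe, two_mul]
    · intro u v h
      exact Subtype.ext (Prod.ext_iff.1 h).1
    · intro u v h
      exact Subtype.ext (Prod.ext_iff.1 h).1
    · rw [Finset.disjoint_left]
      simp only [mem_image, mem_univ, true_and]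
      rintro _ ⟨u, rfl⟩ ⟨v, h⟩
      have h2 := (Prod.ext_iff.1 h).2
      simp only at h2
      exact Finset.disjoint_left.1 hAB (hφ u).1 (h2 ▸ (hφ v).2)
  rw [hcard]

lemma gnpProb_hasCommonNeighbors_le {n : ℕ} {p : ℝ} (hp0 : 0 ≤ p) (hp1 : p ≤ 1) (a b t : ℕ) :
    gnpProb n p {G | HasCommonNeighbors G a b t} ≤
      n.choose a * n.choose b * n.choose t * ((a * b) ^ t * p ^ (2 * t)) := by
  have hsub : {G : SimpleGraph (Fin n) | HasCommonNeighbors G a b t} ⊆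
      {G | ∃ k ∈ (powersetCard a (univ : Finset (Fin n)) ×ˢ powersetCard b univ) ×ˢ
          powersetCard t univ, (Disjoint k.1.1 k.1.2 ∧ Disjoint k.2 (k.1.1 ∪ k.1.2)) ∧
        ∀ u ∈ k.2, (∃ y ∈ k.1.1, G.Adj u y) ∧ ∃ y ∈ k.1.2, G.Adj u y} := by
    rintro G ⟨A, B, T, hAB, hTA, hTB, ha, hb, ht, h⟩
    exact ⟨((A, B), T), by simp [ha, hb, ht], 
      ⟨hAB, disjoint_union_right.2 ⟨hTA, hTB⟩⟩, h⟩
  refine (gnpProb_mono hp0 hp1 hsub).trans ((gnpProb_exists_mem_le_card_mul hp0 hp1 _ _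
    (q := (a * b) ^ t * p ^ (2 * t)) ?_).trans_eq (by simp))
  rintro ⟨⟨A, B⟩, T⟩ hk
  simp only [mem_product, mem_powersetCard_univ] at hk
  by_cases hd : Disjoint A B ∧ Disjoint T (A ∪ B)
  · simp only [hd, true_and]
    rw [← hk.1.1, ← hk.1.2, ← hk.2]
    exact gnpProb_forall_exists_adj_le hp0 hp1 hd.1 hd.2
  · simp only [hd, false_and]
    exact (gnpProb_empty n p).trans_le (by positivity)

end BadEvents

section Deterministic

open Finset
open scoped Classical

lemma SimpleGraph.edist_le_succ_iff {V : Type*} (G : SimpleGraph V) (w u : V) (j : ℕ) :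
    G.edist w u ≤ (j + 1 : ℕ) ↔ G.edist w u ≤ j ∨ ∃ y, G.edist w y ≤ j ∧ G.Adj y u := by
  constructor
  · intro h
    obtain ⟨p, hp⟩ := SimpleGraph.exists_walk_of_edist_ne_top
      (ne_top_of_le_ne_top (ENat.natCast_ne_top _) h)
    rw [← hp, Nat.cast_le] at h
    obtain ⟨q, hq⟩ : ∃ q : G.Walk u w, q.length = p.length := ⟨p.reverse, p.length_reverse⟩
    rw [← hq] at h
    cases q with
    | nil => left; simp
    | cons hadj q =>
      right
      refine ⟨_, ?_, hadj.symm⟩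
      rw [SimpleGraph.edist_comm]
      refine q.edist_le.trans ?_
      rw [SimpleGraph.Walk.length_cons] at h
      exact_mod_cast Nat.le_of_succ_le_succ h
  · rintro (h | ⟨y, hy, hadj⟩)
    · exact h.trans (by exact_mod_cast Nat.le_succ j)
    · refine (G.edist_triangle (v := y)).trans ?_
      rw [SimpleGraph.edist_eq_one_iff_adj.2 hadj]
      push_cast
      gcongr

variable {V : Type*} [Fintype V] {G : SimpleGraph V}

lemma card_edist_le_of_not_hasStar {D : ℕ} (hG : ¬ HasStar G D) (w : V) (j : ℕ) :
    #{u | G.edist w u ≤ j} ≤ D ^ j := by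
  induction j with
  | zero => simp [Finset.filter_eq]
  | succ j ih =>
    have hsub : ({u | G.edist w u ≤ (j + 1 : ℕ)} : Finset V) ⊆
        ({u | G.edist w u ≤ j} : Finset V).biUnion (fun y => insert y ({u | G.Adj y u} : Finset V)) := by
      intro u hu
      rw [mem_filter, G.edist_le_succ_iff] at hu
      simp only [mem_biUnion, mem_filter, mem_univ, true_and, mem_insert]
      rcases hu.2 with h | ⟨y, hy, hadj⟩
      · exact ⟨u, h, Or.inl rfl⟩
      · exact ⟨y, hy, Or.inr hadj⟩
    refine (card_le_card hsub).trans ((card_biUnion_le_card_mul _ _ D fun y _ => ?_).trans ?_)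
    · refine (card_insert_le _ _).trans ?_
      by_contra! h
      obtain ⟨T, hT, hc⟩ := Finset.exists_subset_card_eq (Nat.le_of_lt_succ h)
      have hT' : ∀ u ∈ T, G.Adj y u := fun u hu => (mem_filter.1 (hT hu)).2
      exact hG ⟨y, T, fun hy => G.loopless.irrefl y (hT' y hy), hc, hT'⟩
    · rw [pow_succ]
      gcongr

lemma exists_expansion {a b t : ℕ} (hpair : ¬ HasEmptyPair G a (Fintype.card V - a - 3 * t))
    (hcom : ¬ HasCommonNeighbors G a b t) (hbt : b ≤ t) (hab : a + b ≤ Fintype.card V)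
    {A B : Finset V} (hAB : Disjoint A B) (hA : #A = a) (hB : #B ≤ b) :
    ∃ A' : Finset V, #A' = t ∧ ∀ u ∈ A', u ∉ B ∧ (∃ y ∈ A, G.Adj y u) ∧ ∀ y ∈ B, ¬ G.Adj y u := by
  obtain ⟨B', hBB', hB'A, hB'⟩ : ∃ B', B ⊆ B' ∧ B' ⊆ Aᶜ ∧ #B' = b := by
    refine exists_subsuperset_card_eq (subset_compl_iff_disjoint_left.2 hAB) hB ?_
    rw [card_compl]
    omega
  set S : Finset V := {u | u ∉ A ∧ ∃ y ∈ A, G.Adj u y} with hS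
  have hScard : 3 * t ≤ #S := by
    by_contra! h
    have h1 : Fintype.card V - a - 3 * t ≤ #((A ∪ S)ᶜ) := by
      have := card_union_le A S
      rw [card_compl]
      omega
    obtain ⟨C, hC, hCc⟩ := exists_subset_card_eq h1
    refine hpair ⟨A, C, ?_, hA, hCc, ?_⟩
    · refine Finset.disjoint_left.2 fun u hu hu' => ?_
      have := hC hu'
      simp [hu] at this
    · intro u hu v hv hadj
      have := hC hv
      simp only [mem_compl, mem_union, not_or, hS, mem_filter, mem_univ, true_and] at this
      exact this.2 ⟨this.1, u, hu, hadj.symm⟩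
  set T : Finset V := {u ∈ S \ B' | ∃ y ∈ B', G.Adj u y} with hT
  have hTcard : #T ≤ t := by
    by_contra! h
    obtain ⟨T', hT', hc⟩ := exists_subset_card_eq h.le
    have hmem : ∀ u ∈ T', ((u ∉ A ∧ ∃ y ∈ A, G.Adj u y) ∧ u ∉ B') ∧ ∃ y ∈ B', G.Adj u y := by
      intro u hu
      simpa [hT, hS] using hT' hu
    refine hcom ⟨A, B', T', ?_, ?_, ?_, hA, hB', hc, fun u hu => ?_⟩
    · exact subset_compl_iff_disjoint_left.1 hB'A
    · exact Finset.disjoint_left.2 fun u hu => (hmem u hu).1.1.1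
    · exact Finset.disjoint_left.2 fun u hu => (hmem u hu).1.2
    · exact ⟨(hmem u hu).1.1.2, (hmem u hu).2⟩
  have hcard : t ≤ #((S \ B') \ T) := by
    have h1 := le_card_sdiff B' S
    have h2 := le_card_sdiff T (S \ B')
    omega
  obtain ⟨A', hA', hc⟩ := exists_subset_card_eq hcard
  refine ⟨A', hc, fun u hu => ?_⟩
  have hu' := hA' hu
  rw [Finset.mem_sdiff, Finset.mem_sdiff] at hu'
  obtain ⟨⟨huS, huB⟩, h⟩ := hu'
  obtain ⟨y, hy, hadj⟩ := (mem_filter.1 huS).2.2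
  exact ⟨fun h => huB (hBB' h), ⟨y, hy, hadj.symm⟩,
    fun y hy hadj => h (mem_filter.2
      ⟨Finset.mem_sdiff.2 ⟨huS, huB⟩, y, hBB' hy, hadj.symm⟩)⟩

/-- The pseudorandomness properties of a typical graph from which its metric dimension can be
estimated: bounded degrees (by `D`), expansion (by a factor `m`), few common neighbours, and
edges between large sets. -/
structure IsExpanding (G : SimpleGraph V) (i m D : ℕ) : Prop where
  not_hasStar : ¬ HasStar G D
  not_hasEmptyPair_of_lt : ∀ j < i,
    ¬ HasEmptyPair G (m ^ j) (Fintype.card V - m ^ j - 3 * m ^ (j + 1))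
  not_hasCommonNeighbors : ∀ j < i, ¬ HasCommonNeighbors G (m ^ j) (D ^ j) (m ^ (j + 1))
  not_hasEmptyPair : ¬ HasEmptyPair G (m ^ i) (D ^ i)

namespace IsExpanding

variable {i m D : ℕ}

lemma exists_edist_le_lt (hG : IsExpanding G i m D)
    (h1 : ∀ j < i, D ^ j ≤ m ^ (j + 1)) (h2 : ∀ j < i, m ^ j + D ^ j ≤ Fintype.card V)
    {v w : V} (hvw : v ≠ w) (j : ℕ) (hj : j ≤ i) :
    ∃ A : Finset V, #A = m ^ j ∧ ∀ u ∈ A, G.edist v u ≤ j ∧ j < G.edist w u := by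
  induction j with
  | zero =>
    refine ⟨{v}, by simp, fun u hu => ?_⟩
    rw [mem_singleton] at hu
    subst hu
    simp only [SimpleGraph.edist_self, Nat.cast_zero, le_refl, true_and]
    exact SimpleGraph.edist_pos_of_ne hvw.symm
  | succ j ih =>
    obtain ⟨A, hA, hAvw⟩ := ih (by omega)
    have hji : j < i := by omega
    have hdisj : Disjoint A ({u | G.edist w u ≤ j} : Finset V) := by
      refine Finset.disjoint_left.2 fun u hu hu' => ?_
      exact absurd (mem_filter.1 hu').2 (not_le.2 (hAvw u hu).2)
    obtain ⟨A', hA', h⟩ := exists_expansion (hG.not_hasEmptyPair_of_lt j hji)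
      (hG.not_hasCommonNeighbors j hji) (h1 j hji) (h2 j hji) hdisj hA
      (card_edist_le_of_not_hasStar hG.not_hasStar w j)
    refine ⟨A', hA', fun u hu => ?_⟩
    obtain ⟨huB, ⟨y, hy, hadj⟩, hno⟩ := h u hu
    refine ⟨(G.edist_le_succ_iff v u j).2 (Or.inr ⟨y, (hAvw y hy).1, hadj⟩), ?_⟩
    rw [← not_le, G.edist_le_succ_iff, not_or]
    refine ⟨by simpa using huB, ?_⟩
    rintro ⟨y, hy, hadj⟩
    exact hno y (by simpa using hy) hadj

lemma le_card_dist_ne (hG : IsExpanding G i m D)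
    (h1 : ∀ j < i, D ^ j ≤ m ^ (j + 1)) (h2 : ∀ j < i, m ^ j + D ^ j ≤ Fintype.card V)
    {v w : V} (hvw : v ≠ w) :
    m ^ i - 1 ≤ #{u | G.dist u v ≠ G.dist u w} := by
  obtain ⟨A, hA, h⟩ := hG.exists_edist_le_lt h1 h2 hvw i le_rfl
  have hsub : A.erase v ⊆ ({u | G.dist u v ≠ G.dist u w} : Finset V) := by
    intro u hu
    rw [mem_erase] at hu
    obtain ⟨hv, hw⟩ := h u hu.2
    simp only [mem_filter, mem_univ, true_and]
    rw [SimpleGraph.dist_comm, G.dist_comm (u := u)]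
    intro heq
    have hfin : G.edist v u ≠ ⊤ := ne_top_of_le_ne_top (ENat.natCast_ne_top _) hv
    have hdv : (G.dist v u : ℕ∞) = G.edist v u := ENat.natCast_toNat hfin
    by_cases hwu : G.edist w u = ⊤
    · have h0 : G.dist w u = 0 := by simp [SimpleGraph.dist, hwu]
      rw [heq, h0, Nat.cast_zero, eq_comm, SimpleGraph.edist_eq_zero_iff] at hdv
      exact hu.1 hdv.symm
    · have hdw : (G.dist w u : ℕ∞) = G.edist w u := ENat.natCast_toNat hwu
      rw [← heq, hdv] at hdw
      rw [← hdw] at hw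
      exact absurd hv (not_le.2 hw)
  have := card_le_card hsub
  have := pred_card_le_card_erase (a := v) (s := A)
  omega

lemma card_edist_ne_le (hG : IsExpanding G i m D)
    (h1 : ∀ j < i, D ^ j ≤ m ^ (j + 1)) (h2 : ∀ j < i, m ^ j + D ^ j ≤ Fintype.card V)
    {u w : V} (huw : u ≠ w) :
    #{v | G.edist u v ≠ (i + 1 : ℕ)} ≤ 2 * D ^ i := by
  have hsub : ({v | G.edist u v ≠ (i + 1 : ℕ)} : Finset V) ⊆
      ({v | G.edist u v ≤ i} : Finset V) ∪ ({v | ¬ G.edist u v ≤ (i + 1 : ℕ)} : Finset V) := by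
    intro v hv
    simp only [mem_union, mem_filter, mem_univ, true_and] at hv ⊢
    by_contra! h
    refine hv (le_antisymm h.2 ?_)
    push_cast
    exact Order.add_one_le_of_lt h.1
  have hfar : #{v | ¬ G.edist u v ≤ (i + 1 : ℕ)} ≤ D ^ i := by
    by_contra h
    rw [not_le] at h
    obtain ⟨C, hC, hc⟩ := exists_subset_card_eq h.le
    obtain ⟨A, hA, hAu⟩ := hG.exists_edist_le_lt h1 h2 huw i le_rfl
    have hC' : ∀ v ∈ C, ¬ G.edist u v ≤ (i + 1 : ℕ) := fun v hv =>
      (mem_filter.1 (hC hv)).2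
    refine hG.not_hasEmptyPair ⟨A, C, ?_, hA, hc, fun a ha v hv hadj => ?_⟩
    · refine Finset.disjoint_left.2 fun v hv hv' => hC' v hv' ?_
      exact (G.edist_le_succ_iff u v i).2 (Or.inl (hAu v hv).1)
    · exact hC' v hv ((G.edist_le_succ_iff u v i).2 (Or.inr ⟨a, (hAu a ha).1, hadj⟩))
  have hnear := card_edist_le_of_not_hasStar hG.not_hasStar u i
  have := (card_le_card hsub).trans (card_union_le _ _)
  omega

lemma card_le_of_resolves (hG : IsExpanding G i m D)
    (h1 : ∀ j < i, D ^ j ≤ m ^ (j + 1)) (h2 : ∀ j < i, m ^ j + D ^ j ≤ Fintype.card V)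
    [Nontrivial V] {R : Set V} (hR : R.Finite) (hres : Resolves G R) :
    Fintype.card V ≤ R.ncard * (2 * D ^ i) + 1 := by
  set bad : Finset V := hR.toFinset.biUnion fun u => {v | G.edist u v ≠ (i + 1 : ℕ)}
  have hbad : #bad ≤ R.ncard * (2 * D ^ i) := by
    rw [Set.ncard_eq_toFinset_card R hR]
    refine card_biUnion_le_card_mul _ _ _ fun u _ => ?_
    obtain ⟨w, hw⟩ := exists_ne u
    exact hG.card_edist_ne_le h1 h2 hw.symm
  by_contra! h
  have hc : 1 < #badᶜ := by
    rw [card_compl]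
    omega
  obtain ⟨v, hv, w, hw, hvw⟩ := one_lt_card.1 hc
  obtain ⟨u, hu, hne⟩ := hres hvw
  have key : ∀ z ∈ badᶜ, G.dist u z = i + 1 := by
    intro z hz
    simp only [bad, mem_compl, mem_biUnion, not_exists, not_and, mem_filter, mem_univ, true_and,
      not_not] at hz
    rw [SimpleGraph.dist, hz u (hR.mem_toFinset.2 hu), ENat.toNat_natCast]
  exact hne ((key v hv).trans (key w hw).symm)

end IsExpanding

lemma exists_fun_forall_exists_mem {ι : Type*} (s : Finset ι) (S : ι → Finset V) {k r : ℕ}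
    (hS : ∀ e ∈ s, k ≤ #(S e))
    (hr : #s * (Fintype.card V - k) ^ r < Fintype.card V ^ r) :
    ∃ f : Fin r → V, ∀ e ∈ s, ∃ l, f l ∈ S e := by
  by_contra! h
  have hsub : (univ : Finset (Fin r → V)) ⊆
      s.biUnion fun e => Fintype.piFinset fun _ => (S e)ᶜ := by
    intro f _
    obtain ⟨e, he, hf⟩ := h f
    exact mem_biUnion.2 ⟨e, he, by simpa using hf⟩
  have h1 := (card_le_card hsub).trans (card_biUnion_le_card_mul s _
    ((Fintype.card V - k) ^ r) fun e he => by
      rw [Fintype.card_piFinset_const, card_compl]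
      gcongr
      exact hS e he)
  rw [card_univ, Fintype.card_fun, Fintype.card_fin] at h1
  omega

lemma exists_resolves_of_le_card {k r : ℕ}
    (hk : ∀ v w, v ≠ w → k ≤ #{u | G.dist u v ≠ G.dist u w})
    (hr : Fintype.card V ^ 2 * (Fintype.card V - k) ^ r < Fintype.card V ^ r) :
    ∃ R : Set V, R.Finite ∧ R.ncard ≤ r ∧ Resolves G R := by
  obtain ⟨f, hf⟩ := exists_fun_forall_exists_mem (k := k) (r := r)
    ({e | e.1 ≠ e.2} : Finset (V × V)) (fun e => {u | G.dist u e.1 ≠ G.dist u e.2})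
    (fun e he => hk _ _ (mem_filter.1 he).2) (by
      refine lt_of_le_of_lt ?_ hr
      gcongr
      refine (card_le_univ _).trans_eq ?_
      rw [Fintype.card_prod, sq])
  refine ⟨Set.range f, Set.finite_range f, ?_, fun v w hvw => ?_⟩
  · rw [← Set.image_univ]
    refine (Set.ncard_image_le Set.finite_univ).trans_eq ?_
    rw [Set.ncard_univ, Nat.card_eq_fintype_card, Fintype.card_fin]
  · obtain ⟨l, hl⟩ := hf (v, w) (by simpa using hvw)
    exact ⟨f l, Set.mem_range_self l, by simpa using hl⟩

lemma IsExpanding.metricDim_bounds [Nontrivial V] {i m D r : ℕ} (hG : IsExpanding G i m D)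
    (h1 : ∀ j < i, D ^ j ≤ m ^ (j + 1)) (h2 : ∀ j < i, m ^ j + D ^ j ≤ Fintype.card V)
    (hr : Fintype.card V ^ 2 * (Fintype.card V - (m ^ i - 1)) ^ r < Fintype.card V ^ r) :
    metricDim G ≤ r ∧ Fintype.card V ≤ metricDim G * (2 * D ^ i) + 1 := by
  obtain ⟨R, hR, hRr, hres⟩ := exists_resolves_of_le_card
    (fun v w hvw => hG.le_card_dist_ne h1 h2 hvw) hr
  have hmem : R.ncard ∈ {k : ℕ | ∃ R : Set V, R.Finite ∧ R.ncard = k ∧ Resolves G R} :=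
    ⟨R, hR, rfl, hres⟩
  refine ⟨(Nat.sInf_le hmem).trans hRr, ?_⟩
  obtain ⟨R', hR', hcard, hres'⟩ := Nat.sInf_mem ⟨_, hmem⟩
  rw [metricDim, ← hcard]
  exact hG.card_le_of_resolves h1 h2 hR' hres'

end Deterministic

section Estimates

lemma choose_le_exp_mul_log {n : ℕ} (hn : 0 < n) (k : ℕ) :
    (n.choose k : ℝ) ≤ exp (k * Real.log n) := by
  rw [Real.exp_nat_mul, Real.exp_log (by exact_mod_cast hn)]
  exact_mod_cast Nat.choose_le_pow n k

lemma choose_mul_pow_le_exp_neg (n k : ℕ) {q : ℝ} (hq : 0 ≤ q) (h : 9 * (n * q) ≤ k) :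
    n.choose k * q ^ k ≤ exp (-k) := by
  have h1 : (n.choose k : ℝ) ≤ n ^ k / k.factorial := Nat.choose_le_pow_div k n
  have h2 : (k : ℝ) ^ k / k.factorial ≤ exp k := Real.pow_div_factorial_le_exp k (by positivity) k
  have h3 : exp k * exp k ≤ (9 : ℝ) ^ k := by
    rw [← Real.exp_add, ← mul_two, Real.exp_nat_mul]
    have : exp 2 ≤ 9 := by
      have h := Real.exp_one_lt_d9
      have h' : exp 2 = exp 1 * exp 1 := by rw [← Real.exp_add]; norm_num
      nlinarith [Real.exp_pos 1]
    gcongr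
  calc n.choose k * q ^ k ≤ n ^ k / k.factorial * q ^ k := by gcongr
    _ = (n * q) ^ k / k.factorial := by rw [mul_pow]; ring
    _ ≤ (k / 9) ^ k / k.factorial := by
        gcongr
        linarith
    _ = k ^ k / k.factorial / 9 ^ k := by rw [div_pow]; ring
    _ ≤ exp k / (exp k * exp k) := by gcongr
    _ = exp (-k) := by rw [Real.exp_neg]; field_simp

lemma gnpProb_hasEmptyPair_le_exp {n : ℕ} (hn : 0 < n) {p : ℝ} (hp0 : 0 ≤ p) (hp1 : p ≤ 1)
    (a c : ℕ) : gnpProb n p {G | HasEmptyPair G a c} ≤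
      n.choose c * exp (a * Real.log n - p * a * c) := by
  refine (gnpProb_hasEmptyPair_le hp0 hp1 a c).trans ?_
  have h1 := choose_le_exp_mul_log hn a
  have h2 : (1 - p) ^ (a * c) ≤ exp (-(p * a * c)) := by
    calc (1 - p) ^ (a * c) ≤ exp (-p) ^ (a * c) :=
          pow_le_pow_left₀ (sub_nonneg.2 hp1) (Real.one_sub_le_exp_neg p) _
      _ = exp (-(p * a * c)) := by
          rw [← Real.exp_nat_mul]
          push_cast
          ring_nf
  rw [sub_eq_add_neg (_ * _), Real.exp_add, mul_comm (n.choose a : ℝ), mul_assoc]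
  have : 0 ≤ (1 - p) ^ (a * c) := pow_nonneg (sub_nonneg.2 hp1) _
  gcongr

/-- Quantitative conditions under which the binomial random graph is likely to be expanding. -/
structure ExpansionParams (n : ℕ) (p : ℝ) (i m D : ℕ) : Prop where
  one_le_log : 1 ≤ Real.log n
  p_nonneg : 0 ≤ p
  p_le_one : p ≤ 1
  log_le : 4 * Real.log n ≤ n * p
  mul_log_le : 20 * m * Real.log n ≤ n * p
  mean_le : 9 * (n * p) ≤ D
  one_le : 1 ≤ m
  le : m ≤ D
  pow_mul_log_le : ∀ j < i, 4 * D ^ j * Real.log n ≤ m ^ (j + 1)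
  common_le : ∀ j < i, 9 * (n * D ^ j * p ^ 2) ≤ m
  log_le_pow : 4 * Real.log n ≤ p * m ^ i
  pow_le : ∀ j < i, 8 * m ^ (j + 1) ≤ n

namespace ExpansionParams

variable {n i m D : ℕ} {p : ℝ}

lemma pos (h : ExpansionParams n p i m D) : 0 < n := by
  rcases Nat.eq_zero_or_pos n with rfl | hn
  · have := h.one_le_log
    norm_num at this
  · exact hn

lemma gnpProb_hasStar (h : ExpansionParams n p i m D) : gnpProb n p {G | HasStar G D} ≤ exp (-Real.log n) := by
  refine (gnpProb_hasStar_le h.p_nonneg h.p_le_one D).trans ?_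
  have h1 := choose_mul_pow_le_exp_neg n D h.p_nonneg h.mean_le
  have hn : (0 : ℝ) < n := by exact_mod_cast h.pos
  calc (n : ℝ) * n.choose D * p ^ D = n * (n.choose D * p ^ D) := mul_assoc _ _ _
    _ ≤ exp (Real.log n) * exp (-D) := by rw [Real.exp_log hn]; gcongr
    _ ≤ exp (-Real.log n) := by
        rw [← Real.exp_add, Real.exp_le_exp]
        linarith [h.mean_le, h.log_le, h.one_le_log]

lemma gnpProb_hasEmptyPair (h : ExpansionParams n p i m D) :
    gnpProb n p {G | HasEmptyPair G (m ^ i) (D ^ i)} ≤ exp (-Real.log n) := by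
  refine (gnpProb_hasEmptyPair_le_exp h.pos h.p_nonneg h.p_le_one _ _).trans ?_
  have h1 := choose_le_exp_mul_log h.pos (D ^ i)
  have h2 : (1 : ℝ) ≤ (m ^ i : ℕ) := by exact_mod_cast Nat.one_le_pow _ _ h.one_le
  have h3 : ((m ^ i : ℕ) : ℝ) ≤ (D ^ i : ℕ) := by exact_mod_cast Nat.pow_le_pow_left h.le i
  have h4 : 4 * Real.log n ≤ p * (m ^ i : ℕ) := by exact_mod_cast h.log_le_pow
  have hL := h.one_le_log
  generalize ((m ^ i : ℕ) : ℝ) = a at *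
  generalize ((D ^ i : ℕ) : ℝ) = c at *
  calc _ ≤ exp (c * Real.log n) * exp (a * Real.log n - p * a * c) := by gcongr
    _ ≤ _ := by
        rw [← Real.exp_add, Real.exp_le_exp]
        nlinarith [mul_le_mul_of_nonneg_right h4 (by linarith : 0 ≤ c),
          mul_le_mul_of_nonneg_right h3 (by linarith : 0 ≤ Real.log n),
          mul_le_mul_of_nonneg_right (h2.trans h3) (by linarith : 0 ≤ Real.log n)]

lemma gnpProb_hasEmptyPair_of_lt (h : ExpansionParams n p i m D) {j : ℕ} (hj : j < i) :
    gnpProb n p {G | HasEmptyPair G (m ^ j) (n - m ^ j - 3 * m ^ (j + 1))} ≤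
      exp (-Real.log n) := by
  refine (gnpProb_hasEmptyPair_le_exp h.pos h.p_nonneg h.p_le_one _ _).trans ?_
  have hm := Nat.one_le_pow j m h.one_le
  have hmm : m ^ j ≤ m ^ (j + 1) := Nat.pow_le_pow_right h.one_le (Nat.le_succ j)
  have h8 := h.pow_le j hj
  have hchoose : n.choose (n - m ^ j - 3 * m ^ (j + 1)) = n.choose (m ^ j + 3 * m ^ (j + 1)) := by
    rw [Nat.sub_sub, Nat.choose_symm (by omega)]
  have hhalf : (n : ℝ) / 2 ≤ (n - m ^ j - 3 * m ^ (j + 1) : ℕ) := by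
    rw [div_le_iff₀ two_pos]
    exact_mod_cast (by omega : n ≤ (n - m ^ j - 3 * m ^ (j + 1)) * 2)
  rw [hchoose]
  have h1 := choose_le_exp_mul_log h.pos (m ^ j + 3 * m ^ (j + 1))
  generalize (n - m ^ j - 3 * m ^ (j + 1) : ℕ) = c at *
  push_cast [pow_succ] at h1 ⊢
  have hm' : (1 : ℝ) ≤ (m : ℝ) ^ j := by exact_mod_cast hm
  have hm1 : (1 : ℝ) ≤ m := by exact_mod_cast h.one_le
  generalize (m : ℝ) ^ j = a at *
  have hL := h.one_le_log
  calc _ ≤ exp ((a + 3 * (a * m)) * Real.log n) * exp (a * Real.log n - p * a * c) := by gcongr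
    _ ≤ _ := by
        rw [← Real.exp_add, Real.exp_le_exp]
        have e1 : p * (n / 2) * a ≤ p * c * a := by
          have := h.p_nonneg
          gcongr
        have e2 : a * Real.log n ≤ a * m * Real.log n := by
          have : a * 1 ≤ a * m := by gcongr
          nlinarith
        have e3 : a * (20 * m * Real.log n) ≤ a * (n * p) := by
          have := h.mul_log_le
          gcongr
        have e4 : 1 * (4 * Real.log n) ≤ a * (n * p) := by
          have := h.log_le
          gcongr
        linarith

lemma gnpProb_hasCommonNeighbors (h : ExpansionParams n p i m D) {j : ℕ} (hj : j < i) :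
    gnpProb n p {G | HasCommonNeighbors G (m ^ j) (D ^ j) (m ^ (j + 1))} ≤
      exp (-Real.log n) := by
  refine (gnpProb_hasCommonNeighbors_le h.p_nonneg h.p_le_one _ _ _).trans ?_
  have h1 := choose_le_exp_mul_log h.pos (m ^ j)
  have h2 := choose_le_exp_mul_log h.pos (D ^ j)
  have h3 := choose_mul_pow_le_exp_neg n (m ^ (j + 1)) (q := (m ^ j : ℕ) * (D ^ j : ℕ) * p ^ 2)
    (by positivity) (by
      have := h.common_le j hj
      push_cast
      calc 9 * (n * (m ^ j * D ^ j * p ^ 2)) = m ^ j * (9 * (n * D ^ j * p ^ 2)) := by ring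
        _ ≤ (m : ℝ) ^ j * m := by gcongr
        _ = m ^ (j + 1) := (pow_succ _ _).symm)
  have h4 := h.pow_mul_log_le j hj
  have hL := h.one_le_log
  have h5 : ((m ^ j : ℕ) : ℝ) ≤ (D ^ j : ℕ) := by exact_mod_cast Nat.pow_le_pow_left h.le j
  have h6 : (1 : ℝ) ≤ (m ^ j : ℕ) := by exact_mod_cast Nat.one_le_pow j m h.one_le
  rw [mul_pow, ← pow_mul] at h3
  have hp0 := h.p_nonneg
  calc _ = (n.choose (m ^ j) : ℝ) * n.choose (D ^ j) * (n.choose (m ^ (j + 1)) *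
        (((m ^ j : ℕ) * (D ^ j : ℕ)) ^ m ^ (j + 1) * p ^ (2 * m ^ (j + 1)))) := by ring
    _ ≤ exp ((m ^ j : ℕ) * Real.log n) * exp ((D ^ j : ℕ) * Real.log n) *
        exp (-(m ^ (j + 1) : ℕ)) := by gcongr
    _ ≤ _ := by
        rw [← Real.exp_add, ← Real.exp_add, Real.exp_le_exp]
        push_cast at h5 h6 ⊢
        nlinarith

lemma gnpProb_not_isExpanding (h : ExpansionParams n p i m D) :
    gnpProb n p {G | ¬ IsExpanding G i m D} ≤ (2 * i + 2) * exp (-Real.log n) := by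
  have hp0 := h.p_nonneg
  have hp1 := h.p_le_one
  have hsub : {G : SimpleGraph (Fin n) | ¬ IsExpanding G i m D} ⊆
      {G | (HasStar G D ∨ HasEmptyPair G (m ^ i) (D ^ i)) ∨
        (∃ j ∈ Finset.range i, HasEmptyPair G (m ^ j) (n - m ^ j - 3 * m ^ (j + 1))) ∨
        ∃ j ∈ Finset.range i, HasCommonNeighbors G (m ^ j) (D ^ j) (m ^ (j + 1))} := by
    intro G hG
    by_contra hcon
    simp only [Set.mem_ofPred_eq, not_or, not_exists, not_and, Finset.mem_range] at hcon
    refine hG ⟨hcon.1.1, ?_, hcon.2.2, hcon.1.2⟩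
    rw [Fintype.card_fin]
    exact hcon.2.1
  refine (gnpProb_mono hp0 hp1 hsub).trans ?_
  have h1 := gnpProb_exists_mem_le_card_mul hp0 hp1 (Finset.range i)
    (fun j (G : SimpleGraph (Fin n)) => HasEmptyPair G (m ^ j) (n - m ^ j - 3 * m ^ (j + 1)))
    fun j hj => h.gnpProb_hasEmptyPair_of_lt (Finset.mem_range.1 hj)
  have h2 := gnpProb_exists_mem_le_card_mul hp0 hp1 (Finset.range i)
    (fun j (G : SimpleGraph (Fin n)) => HasCommonNeighbors G (m ^ j) (D ^ j) (m ^ (j + 1)))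
    fun j hj => h.gnpProb_hasCommonNeighbors (Finset.mem_range.1 hj)
  rw [Finset.card_range] at h1 h2
  refine (gnpProb_or_le hp0 hp1 _ _).trans ?_
  refine (add_le_add (gnpProb_or_le hp0 hp1 _ _) (gnpProb_or_le hp0 hp1 _ _)).trans ?_
  linarith [h.gnpProb_hasStar, h.gnpProb_hasEmptyPair]

lemma pow_le_pow_succ (h : ExpansionParams n p i m D) {j : ℕ} (hj : j < i) : D ^ j ≤ m ^ (j + 1) := by
  have h1 := h.pow_mul_log_le j hj
  have h2 := h.one_le_log
  have h3 : (0 : ℝ) ≤ (D : ℝ) ^ j := by positivity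
  exact_mod_cast (by nlinarith : (D : ℝ) ^ j ≤ (m : ℝ) ^ (j + 1))

lemma pow_add_pow_le (h : ExpansionParams n p i m D) {j : ℕ} (hj : j < i) : m ^ j + D ^ j ≤ n := by
  have h1 := h.pow_le j hj
  have h2 := h.pow_le_pow_succ hj
  have h3 : m ^ j ≤ m ^ (j + 1) := Nat.pow_le_pow_right h.one_le (Nat.le_succ j)
  omega

end ExpansionParams

lemma sq_mul_sub_pow_lt {n k r : ℕ} (hn : 0 < n) (hk : k ≤ n)
    (h : 2 * n * Real.log n < k * r) : n ^ 2 * (n - k) ^ r < n ^ r := by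
  have hn' : (0 : ℝ) < n := by exact_mod_cast hn
  have hsub : ((n - k : ℕ) : ℝ) ≤ n * exp (-(k / n)) := by
    rw [Nat.cast_sub hk]
    have := Real.one_sub_le_exp_neg ((k : ℝ) / n)
    calc (n : ℝ) - k = n * (1 - k / n) := by field_simp
      _ ≤ _ := by gcongr
  have hmain : (n : ℝ) ^ 2 * ((n - k : ℕ) : ℝ) ^ r < n ^ r := by
    calc (n : ℝ) ^ 2 * ((n - k : ℕ) : ℝ) ^ r ≤ n ^ 2 * (n * exp (-(k / n))) ^ r := by gcongr
      _ = n ^ r * exp (2 * Real.log n - k * r / n) := by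
          rw [mul_pow, ← Real.exp_nat_mul, sub_eq_add_neg, Real.exp_add]
          have : exp (2 * Real.log n) = (n : ℝ) ^ 2 := by
            rw [mul_comm, Real.exp_mul, Real.exp_log hn']
            norm_num
          rw [this]
          ring_nf
      _ < n ^ r * 1 := by
          gcongr
          rw [Real.exp_lt_one_iff, sub_neg, lt_div_iff₀ hn']
          linarith
      _ = n ^ r := mul_one _
  exact_mod_cast hmain

end Estimates

section Asymptotics

lemma eventually_mul_rpow_mul_log_le {a b : ℝ} (hab : a < b) {C : ℝ} (hC : 0 ≤ C) :
    ∀ᶠ n : ℕ in atTop, C * (n : ℝ) ^ a * Real.log n ≤ (n : ℝ) ^ b := by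
  have h := ((isLittleO_log_rpow_atTop (sub_pos.2 hab)).const_mul_left C).comp_tendsto
    tendsto_natCast_atTop_atTop
  filter_upwards [h.bound one_pos, eventually_gt_atTop 0] with n hn hn0
  have hn' : (0 : ℝ) < n := by exact_mod_cast hn0
  simp only [Function.comp_apply, one_mul, Real.norm_eq_abs] at hn
  rw [abs_of_nonneg (mul_nonneg hC (Real.log_natCast_nonneg n)),
    abs_of_nonneg (by positivity)] at hn
  calc C * (n : ℝ) ^ a * Real.log n = n ^ a * (C * Real.log n) := by ring
    _ ≤ n ^ a * n ^ (b - a) := by gcongr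
    _ = n ^ b := by rw [← Real.rpow_add hn']; congr 1; ring

lemma eventually_one_le_log : ∀ᶠ n : ℕ in atTop, 1 ≤ Real.log n :=
  (Real.tendsto_log_atTop.comp tendsto_natCast_atTop_atTop).eventually_ge_atTop 1

lemma eventually_mul_rpow_le {a b : ℝ} (hab : a < b) {C : ℝ} (hC : 0 ≤ C) :
    ∀ᶠ n : ℕ in atTop, C * (n : ℝ) ^ a ≤ (n : ℝ) ^ b := by
  filter_upwards [eventually_mul_rpow_mul_log_le hab hC, eventually_one_le_log] with n h h1
  exact (le_mul_of_one_le_right (by positivity) h1).trans h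

lemma eventually_ceil_rpow_le {a b : ℝ} (ha : 0 ≤ a) (hab : a < b) :
    ∀ᶠ n : ℕ in atTop, (⌈(n : ℝ) ^ a⌉₊ : ℝ) ≤ (n : ℝ) ^ b := by
  filter_upwards [eventually_mul_rpow_le hab zero_le_two, eventually_ge_atTop 1] with n h hn
  have h1 : 1 ≤ (n : ℝ) ^ a := Real.one_le_rpow (by exact_mod_cast hn) ha
  have h2 := Nat.ceil_lt_add_one (zero_le_one.trans h1)
  linarith

lemma eventually_forall_lt {i : ℕ} {P : ℕ → ℕ → Prop} (h : ∀ j < i, ∀ᶠ n in atTop, P j n) :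
    ∀ᶠ n in atTop, ∀ j < i, P j n :=
  (eventually_all_finite (Set.finite_Iio i)).2 h

lemma eventually_expansionParams {x ε : ℝ} {i : ℕ} (hx1 : x < 1) (hε : 0 < ε)
    (h1 : (4 * i + 2) * ε < x) (h2 : i * (x + 2 * ε) < 1) (h3 : 1 < x + i * (x - 2 * ε)) :
    ∀ᶠ n : ℕ in atTop, ExpansionParams n ((n : ℝ) ^ (x - 1)) i
      ⌈(n : ℝ) ^ (x - 2 * ε)⌉₊ ⌈(n : ℝ) ^ (x + ε)⌉₊ := by
  have hiε : 0 ≤ i * ε := by positivity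
  have hx : 0 < x - 2 * ε := by linarith
  have hlt : ∀ j < i, (j : ℝ) + 1 ≤ i := fun j hj => by exact_mod_cast hj
  have hlog := eventually_one_le_log
  filter_upwards [hlog, eventually_ge_atTop 1,
    eventually_ceil_rpow_le hx.le (by linarith : x - 2 * ε < x - ε),
    eventually_ceil_rpow_le (by linarith : 0 ≤ x + ε) (by linarith : x + ε < x + 2 * ε),
    eventually_mul_rpow_mul_log_le (by linarith : (0 : ℝ) < x) (by norm_num : (0 : ℝ) ≤ 4),
    eventually_mul_rpow_mul_log_le (by linarith : x - ε < x) (by norm_num : (0 : ℝ) ≤ 20),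
    eventually_mul_rpow_le (by linarith : x < x + ε) (by norm_num : (0 : ℝ) ≤ 9),
    eventually_forall_lt fun j (hj : j < i) => eventually_mul_rpow_mul_log_le
      (show (x + 2 * ε) * j < (x - 2 * ε) * ((j + 1 : ℕ) : ℝ) by
        have := mul_le_mul_of_nonneg_right (hlt j hj) hε.le
        push_cast
        linarith) (by norm_num : (0 : ℝ) ≤ 4),
    eventually_forall_lt fun j (hj : j < i) => eventually_mul_rpow_le
      (show 1 + (x + 2 * ε) * j + (x - 1) * (2 : ℕ) < x - 2 * ε by
        have := mul_le_mul_of_nonneg_right (hlt j hj) (by linarith : 0 ≤ x + 2 * ε)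
        push_cast
        linarith) (by norm_num : (0 : ℝ) ≤ 9),
    eventually_mul_rpow_mul_log_le (show 0 < x - 1 + (x - 2 * ε) * i by linarith)
      (by norm_num : (0 : ℝ) ≤ 4),
    eventually_forall_lt fun j (hj : j < i) => eventually_mul_rpow_le
      (show (x - ε) * ((j + 1 : ℕ) : ℝ) < 1 by
        have := mul_le_mul_of_nonneg_right (hlt j hj) (by linarith : 0 ≤ x - ε)
        push_cast
        linarith) (by norm_num : (0 : ℝ) ≤ 8)] with
    n hL hn hm hD e1 e2 e3 e4 e5 e6 e7
  have hn0 : (0 : ℝ) < n := by exact_mod_cast hn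
  have hn1 : (1 : ℝ) ≤ n := by exact_mod_cast hn
  have hmean : (n : ℝ) * n ^ (x - 1) = n ^ x := by
    rw [Real.rpow_sub_one hn0.ne', mul_div_cancel₀ _ hn0.ne']
  have hm' := Nat.le_ceil ((n : ℝ) ^ (x - 2 * ε))
  have hD' := Nat.le_ceil ((n : ℝ) ^ (x + ε))
  have hone : 1 ≤ (n : ℝ) ^ (x - 2 * ε) := Real.one_le_rpow hn1 hx.le
  have hle : (n : ℝ) ^ (x - 2 * ε) ≤ n ^ (x + ε) :=
    Real.rpow_le_rpow_of_exponent_le hn1 (by linarith)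
  have hml : ⌈(n : ℝ) ^ (x - 2 * ε)⌉₊ ≤ ⌈(n : ℝ) ^ (x + ε)⌉₊ := Nat.ceil_le_ceil hle
  generalize ⌈(n : ℝ) ^ (x - 2 * ε)⌉₊ = m at *
  generalize ⌈(n : ℝ) ^ (x + ε)⌉₊ = D at *
  rw [Real.rpow_zero, mul_one] at e1 e6
  have hDj : ∀ j : ℕ, (D : ℝ) ^ j ≤ n ^ ((x + 2 * ε) * j) := fun j => by
    rw [Real.rpow_mul_natCast hn0.le]
    gcongr
  have hmj : ∀ j : ℕ, (n : ℝ) ^ ((x - 2 * ε) * j) ≤ m ^ j := fun j => by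
    rw [Real.rpow_mul_natCast hn0.le]
    gcongr
  refine ⟨hL, by positivity, Real.rpow_le_one_of_one_le_of_nonpos hn1 (by linarith), ?_, ?_, ?_,
    ?_, hml, fun j hj => ?_, fun j hj => ?_, ?_, fun j hj => ?_⟩
  · rwa [hmean]
  · rw [hmean]
    refine le_trans ?_ e2
    gcongr
  · rw [hmean]
    exact e3.trans hD'
  · exact_mod_cast hone.trans hm'
  · refine le_trans ?_ ((e4 j hj).trans (hmj _))
    have := hDj j
    gcongr
  · refine le_trans ?_ ((e5 j hj).trans hm')
    rw [Real.rpow_add hn0, Real.rpow_add hn0, Real.rpow_one, Real.rpow_mul_natCast hn0.le (x - 1)]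
    have := hDj j
    gcongr
  · refine e6.trans ?_
    rw [Real.rpow_add hn0]
    have := hmj i
    gcongr
  · have h := e7 j hj
    rw [Real.rpow_one, Real.rpow_mul_natCast hn0.le] at h
    have : (8 : ℝ) * m ^ (j + 1) ≤ n := le_trans (by gcongr) h
    exact_mod_cast this

lemma eventually_abs_log_metricDim_sub_le {x ε δ : ℝ} {i : ℕ} (hx1 : x < 1) (hε : 0 < ε)
    (hi : 1 ≤ i) (h1 : (4 * i + 2) * ε < x) (h2 : i * (x + 2 * ε) < 1)
    (h3 : 1 < x + i * (x - 2 * ε)) (h4 : 2 * i * ε < δ) :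
    ∀ᶠ n : ℕ in atTop, ∀ G : SimpleGraph (Fin n),
      IsExpanding G i ⌈(n : ℝ) ^ (x - 2 * ε)⌉₊ ⌈(n : ℝ) ^ (x + ε)⌉₊ →
        |Real.log (metricDim G) / Real.log n - (1 - x * i)| ≤ δ := by
  have hiε : 0 ≤ i * ε := by positivity
  have hδ : 0 < δ := by linarith
  have hix : x * i < 1 := by linarith
  filter_upwards [eventually_expansionParams hx1 hε h1 h2 h3, eventually_ge_atTop 2,
    eventually_ceil_rpow_le (by linarith : 0 ≤ x + ε) (by linarith : x + ε < x + 2 * ε),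
    eventually_mul_rpow_mul_log_le (show 1 < (x - 2 * ε) * i + (1 - x * i + δ) by linarith)
      (by norm_num : (0 : ℝ) ≤ 12),
    eventually_mul_rpow_le (show (0 : ℝ) < 1 - x * i + δ by linarith) zero_le_two,
    eventually_mul_rpow_le (show (x + 2 * ε) * i + (1 - x * i - δ) < 1 by linarith)
      (by norm_num : (0 : ℝ) ≤ 4)] with n hP hn hD e1 e2 e3 G hG
  have hL := hP.one_le_log
  have hn0 : (0 : ℝ) < n := by exact_mod_cast hP.pos
  have : Nontrivial (Fin n) := Fin.nontrivial_iff_two_le.2 hn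
  have hm' := Nat.le_ceil ((n : ℝ) ^ (x - 2 * ε))
  have hm1 := hP.one_le
  have hmi := hP.log_le_pow
  have hmn := hP.pow_le (i - 1) (by omega)
  rw [Nat.sub_add_cancel hi] at hmn
  generalize ⌈(n : ℝ) ^ (x - 2 * ε)⌉₊ = m at *
  generalize ⌈(n : ℝ) ^ (x + ε)⌉₊ = D at *
  rw [Real.rpow_zero] at e2
  have hmi2 : (2 : ℝ) ≤ m ^ i := by
    have h := mul_le_of_le_one_left (by positivity : (0 : ℝ) ≤ m ^ i) hP.p_le_one
    linarith
  have hrle := Nat.floor_le (by positivity : 0 ≤ (n : ℝ) ^ (1 - x * i + δ))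
  have hrlt := Nat.lt_floor_add_one ((n : ℝ) ^ (1 - x * i + δ))
  set r := ⌊(n : ℝ) ^ (1 - x * i + δ)⌋₊
  have hk : ((m ^ i - 1 : ℕ) : ℝ) = m ^ i - 1 := by
    rw [Nat.cast_sub (Nat.one_le_pow _ _ hm1)]
    push_cast
    rfl
  have hkr : 2 * n * Real.log n < (m ^ i - 1 : ℕ) * r := by
    rw [hk]
    calc 2 * n * Real.log n < 12 * n * Real.log n / 4 := by nlinarith
      _ ≤ (m ^ i / 2) * (n ^ (1 - x * i + δ) / 2) := by
          have : 12 * n * Real.log n ≤ m ^ i * (n : ℝ) ^ (1 - x * i + δ) := by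
            rw [Real.rpow_add hn0, Real.rpow_one, Real.rpow_mul_natCast hn0.le] at e1
            refine e1.trans ?_
            gcongr
          linarith
      _ ≤ _ := by
          gcongr <;> linarith
  have hr := sq_mul_sub_pow_lt (k := m ^ i - 1) hP.pos (by omega) hkr
  have hbounds := hG.metricDim_bounds (r := r) (fun j hj => hP.pow_le_pow_succ hj)
    (by simpa using fun j hj => hP.pow_add_pow_le hj) (by simpa using hr)
  rw [Fintype.card_fin] at hbounds
  obtain ⟨hup, hlow⟩ := hbounds
  have hpos : 0 < metricDim G := by
    by_contra! h
    rw [Nat.le_zero.1 h] at hlow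
    omega
  have hpos' : (0 : ℝ) < metricDim G := by exact_mod_cast hpos
  have hLpos : 0 < Real.log n := by linarith
  rw [abs_le]
  constructor
  · have hb : (n : ℝ) ^ (1 - x * i - δ) ≤ metricDim G := by
      have hlow' : (n : ℝ) ≤ metricDim G * (2 * D ^ i) + 1 := by exact_mod_cast hlow
      have hn2 : (2 : ℝ) ≤ n := by exact_mod_cast hn
      have hDi : (D : ℝ) ^ i ≤ n ^ ((x + 2 * ε) * i) := by
        rw [Real.rpow_mul_natCast hn0.le]
        gcongr
      rw [Real.rpow_add hn0, Real.rpow_one] at e3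
      have hz : 0 < (n : ℝ) ^ ((x + 2 * ε) * i) := by positivity
      have h5 : (metricDim G : ℝ) * (2 * D ^ i) ≤ metricDim G * (2 * n ^ ((x + 2 * ε) * i)) := by
        gcongr
      by_contra! hcon
      have h6 := mul_lt_mul_of_pos_right hcon hz
      linarith
    have hlog := Real.log_le_log (by positivity) hb
    rw [Real.log_rpow hn0] at hlog
    have := (le_div_iff₀ hLpos).2 hlog
    linarith
  · have hb : (metricDim G : ℝ) ≤ n ^ (1 - x * i + δ) :=
      le_trans (by exact_mod_cast hup) hrle
    have hlog := Real.log_le_log hpos' hb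
    rw [Real.log_rpow hn0] at hlog
    have := (div_le_iff₀ hLpos).2 hlog
    linarith

end Asymptotics

/-- The "zigzag" behaviour: for fixed `x ∈ (0,1)` with `1/x` not an integer and
`i = ⌊1/x⌋`, in `G(n, n^{x−1})` the quantity `log β(G)/log n` converges in
probability to `1 − x⌊1/x⌋`, i.e. a.a.s. `β(G) = n^{1−ix+o(1)}`. -/
theorem stmt_16 (x : ℝ) (hx0 : 0 < x) (hx1 : x < 1)
    (hxnint : ∀ m : ℤ, (1 : ℝ) / x ≠ (m : ℝ))
    (i : ℕ) (hi : i = ⌊(1 : ℝ) / x⌋₊) :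
    ∀ δ : ℝ, 0 < δ →
      Tendsto (fun n : ℕ => gnpProb n ((n : ℝ) ^ (x - 1))
        {G : SimpleGraph (Fin n) |
          |Real.log (metricDim G) / Real.log n - (1 - x * i)| ≤ δ})
        atTop (𝓝 1) := by
  intro δ hδ
  have hi1 : 1 ≤ i := by
    rw [hi, Nat.one_le_floor_iff, le_div_iff₀ hx0, one_mul]
    exact hx1.le
  have hix : x * i < 1 := by
    have h := Nat.floor_le (by positivity : 0 ≤ 1 / x)
    rw [← hi] at h
    have h' := h.lt_of_ne fun h => hxnint i (by rw [← h, Int.cast_natCast])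
    rwa [lt_div_iff₀ hx0, mul_comm] at h'
  have hix' : 1 < x * i + x := by
    have h := Nat.lt_floor_add_one (1 / x)
    rw [← hi, div_lt_iff₀ hx0] at h
    linarith
  obtain ⟨η, hη, hη1⟩ := exists_between (show 0 < min (min x δ) (min (1 - x * i) (x * i + x - 1)) by
    simp only [lt_min_iff]
    exact ⟨⟨hx0, hδ⟩, by linarith, by linarith⟩)
  simp only [lt_min_iff] at hη1
  obtain ⟨⟨hηx, hηδ⟩, hη2, hη3⟩ := hη1
  set ε := η / (4 * i + 2)
  have hε : 0 < ε := by positivity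
  have hεη : (4 * i + 2) * ε = η := mul_div_cancel₀ _ (by positivity)
  have hiε : 0 ≤ i * ε := by positivity
  have hev := eventually_expansionParams (i := i) hx1 hε (by linarith) (by linarith) (by linarith)
  have hevG := eventually_abs_log_metricDim_sub_le (δ := δ) hx1 hε hi1 (by linarith) (by linarith)
    (by linarith) (by linarith)
  have hlim : Tendsto (fun n : ℕ => 1 - (2 * i + 2) * exp (-Real.log n)) atTop (𝓝 1) := by
    have h := (Real.tendsto_exp_neg_atTop_nhds_zero.comp
      (Real.tendsto_log_atTop.comp tendsto_natCast_atTop_atTop)).const_mul (2 * (i : ℝ) + 2)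
    simpa using h.const_sub 1
  refine tendsto_of_tendsto_of_tendsto_of_le_of_le' hlim tendsto_const_nhds ?_ ?_
  · filter_upwards [hev, hevG] with n hP hG
    have h1 := hP.gnpProb_not_isExpanding
    have h2 := gnpProb_add_compl n ((n : ℝ) ^ (x - 1)) {G : SimpleGraph (Fin n) |
      IsExpanding G i ⌈(n : ℝ) ^ (x - 2 * ε)⌉₊ ⌈(n : ℝ) ^ (x + ε)⌉₊}
    rw [Set.compl_ofPred] at h2
    refine le_trans ?_ (gnpProb_mono hP.p_nonneg hP.p_le_one (Set.ofPred_subset_ofPred.2 hG))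
    linarith
  · filter_upwards [hev] with n hP
    exact (gnpProb_mono hP.p_nonneg hP.p_le_one (Set.subset_univ _)).trans_eq (gnpProb_univ _ _)
end
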